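/- arXiv:0805.3444 — 3 statements merged into one kernel-verified Lean document; each statement's English description precedes it below -/
import Mathlib

section
/- Let (V, d, m) be a B∞-algebra, i.e. (T(V), m, Δ, η, ε, d) is a differential graded bialgebra where Δ is the deconcatenation coproduct. If γ ∈ V has degree 1 and satisfies the Maurer–Cartan equation d₁(γ) + m_{1,1}(γ⊗γ) = 0, then the twisted coderivation d_γ := d + m(γ⊗−) − m(−⊗γ) (with Koszul signs) squares to zero and is a derivation with respect to m, so (T(V), m, Δ, η, ε, d_γ) is again a DG bialgebra. -/
open scoped TensorProduct BigOperators Classical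

noncomputable section

namespace BInfty

variable (k : Type) [Field k] (ι : Type)

/-- Model of the tensor coalgebra `T(V)` over a graded vector space `V` with homogeneous
basis indexed by `ι`: its basis is given by lists of basis vectors. -/
abbrev TV := List ι →₀ k

variable {k ι}

def sgn (n : ℤ) : k := if Even n then 1 else -1

variable (d : ι → ℤ)

/-- the degree of a basis element of `T(V)`. -/
def degL (l : List ι) : ℤ := (l.map d).sum

/-- the deconcatenation coproduct of `T(V)`. -/
def Δ : TV k ι →ₗ[k] TV k ι ⊗[k] TV k ι :=
  Finsupp.lsum k fun l => LinearMap.toSpanSingleton k _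
    (∑ i ∈ Finset.range (l.length + 1),
      Finsupp.single (l.take i) (1 : k) ⊗ₜ[k] Finsupp.single (l.drop i) (1 : k))

/-- the counit of `T(V)`. -/
def ε : TV k ι →ₗ[k] k := Finsupp.lapply []

/-- the unit `η(1)` of `T(V)`. -/
def ηone : TV k ι := Finsupp.single [] 1

/-- the parity operator `σ = (-1)^{deg}` implementing Koszul's sign rule. -/
def par : TV k ι →ₗ[k] TV k ι :=
  Finsupp.lsum k fun l => LinearMap.toSpanSingleton k _
    ((sgn (degL d l) : k) • Finsupp.single l (1 : k))

/-- the graded braiding `τ(x ⊗ y) = (-1)^{|x||y|} y ⊗ x`. -/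
def braid : TV k ι ⊗[k] TV k ι →ₗ[k] TV k ι ⊗[k] TV k ι :=
  TensorProduct.lift (Finsupp.lsum k fun l₁ =>
    LinearMap.toSpanSingleton k _ (Finsupp.lsum k fun l₂ =>
      LinearMap.toSpanSingleton k _
        ((sgn (degL d l₁ * degL d l₂) : k) •
          (Finsupp.single l₂ (1 : k) ⊗ₜ[k] Finsupp.single l₁ (1 : k)))))

/-- the signed middle-four exchange `1 ⊗ τ ⊗ 1`. -/
def mid : (TV k ι ⊗[k] TV k ι) ⊗[k] (TV k ι ⊗[k] TV k ι) →ₗ[k]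
    (TV k ι ⊗[k] TV k ι) ⊗[k] (TV k ι ⊗[k] TV k ι) :=
  ((TensorProduct.assoc k (TV k ι) (TV k ι) (TV k ι ⊗[k] TV k ι)).symm.toLinearMap)
    ∘ₗ (TensorProduct.map LinearMap.id
        ((TensorProduct.assoc k (TV k ι) (TV k ι) (TV k ι)).toLinearMap
          ∘ₗ (TensorProduct.map (braid d) LinearMap.id)
          ∘ₗ (TensorProduct.assoc k (TV k ι) (TV k ι) (TV k ι)).symm.toLinearMap))
    ∘ₗ (TensorProduct.assoc k (TV k ι) (TV k ι) (TV k ι ⊗[k] TV k ι)).toLinearMap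

/-- the embedding `V ↪ T(V)`. -/
def embV (a : ι →₀ k) : TV k ι := a.sum fun i c => Finsupp.single [i] c

/-- the projection onto the cogenerators, `T(V) ↠ V`. -/
def piV (p : TV k ι) : ι →₀ k :=
  p.sum fun l c => match l with
    | [j] => Finsupp.single j c
    | _ => 0

end BInfty

open BInfty TensorProduct

namespace BInfty

variable {k ι : Type} [Field k] (d : ι → ℤ)

theorem sgn_add (a b : ℤ) : (sgn (a + b) : k) = sgn a * sgn b := by
  unfold sgn; by_cases ha : Even a <;> by_cases hb : Even b <;> simp [Int.even_add, ha, hb]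

theorem sgn_mul_self (a : ℤ) : (sgn a * sgn a : k) = 1 := by
  unfold sgn; split_ifs <;> simp

theorem sgn_mul (a b : ℤ) : (sgn (a * b) : k) = if Even a then 1 else sgn b := by
  unfold sgn; by_cases ha : Even a <;> by_cases hb : Even b <;> simp [Int.even_mul, ha, hb]

/-- Linear maps out of `T(V)` agree when they agree on the basis of words. -/
theorem TV_hom_ext {M : Type*} [AddCommMonoid M] [Module k M] {f g : TV k ι →ₗ[k] M}
    (h : ∀ l : List ι, f (Finsupp.single l 1) = g (Finsupp.single l 1)) : f = g := by
  refine Finsupp.lhom_ext' fun l => LinearMap.ext_ring ?_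
  simpa using h l

theorem par_single (l : List ι) :
    par d (Finsupp.single l 1) = (sgn (degL d l) : k) • Finsupp.single l (1 : k) := by
  simp [par]

theorem par_ηone : par d (ηone : TV k ι) = ηone := by
  simp [ηone, par_single, degL, sgn]

theorem par_comp_par : par d ∘ₗ par d = (LinearMap.id : TV k ι →ₗ[k] TV k ι) := by
  apply TV_hom_ext
  intro l
  simp only [LinearMap.comp_apply, par_single, map_smul, smul_smul, sgn_mul_self, one_smul,
    LinearMap.id_apply]

theorem par_par (x : TV k ι) : par d (par d x) = x :=
  LinearMap.congr_fun (par_comp_par d) x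

theorem Δ_single (l : List ι) :
    Δ (Finsupp.single l (1 : k)) = ∑ i ∈ Finset.range (l.length + 1),
      Finsupp.single (l.take i) (1 : k) ⊗ₜ[k] Finsupp.single (l.drop i) (1 : k) := by
  simp [Δ]

theorem Δ_comp_par :
    Δ ∘ₗ par d = TensorProduct.map (par d) (par d) ∘ₗ (Δ : TV k ι →ₗ[k] _) := by
  apply TV_hom_ext
  intro l
  simp only [LinearMap.comp_apply, par_single, map_smul, Δ_single, map_sum,
    TensorProduct.map_tmul, Finset.smul_sum, smul_tmul_smul]
  refine Finset.sum_congr rfl fun i _ => ?_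
  rw [← sgn_add]
  congr 2
  simp [degL, ← List.sum_append]

theorem par_embV {γ : ι →₀ k} (hγ : ∀ i ∈ γ.support, d i = 1) :
    par d (embV γ) = -embV γ := by
  unfold embV
  rw [Finsupp.sum, map_sum, ← Finset.sum_neg_distrib]
  refine Finset.sum_congr rfl fun i hi => ?_
  rw [← mul_one (γ i), ← smul_eq_mul, ← Finsupp.smul_single, map_smul, par_single]
  simp [degL, hγ i hi, sgn]

/-- An element is primitive if `Δ p = p ⊗ 1 + 1 ⊗ p`. -/
def IsPrim (p : TV k ι) : Prop := Δ p = p ⊗ₜ[k] ηone + ηone ⊗ₜ[k] p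

theorem isPrim_embV (γ : ι →₀ k) : IsPrim (embV γ) := by
  unfold IsPrim embV
  rw [Finsupp.sum, map_sum, TensorProduct.sum_tmul, TensorProduct.tmul_sum,
    ← Finset.sum_add_distrib]
  refine Finset.sum_congr rfl fun i _ => ?_
  rw [← mul_one (γ i), ← smul_eq_mul, ← Finsupp.smul_single, map_smul, Δ_single]
  rw [← TensorProduct.smul_tmul', TensorProduct.tmul_smul, ← smul_add]
  simp [Finset.sum_range_succ, ηone, add_comm]

theorem braid_single (l l' : List ι) :
    braid d (Finsupp.single l (1 : k) ⊗ₜ[k] Finsupp.single l' (1 : k)) =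
      (sgn (degL d l * degL d l') : k) •
        (Finsupp.single l' (1 : k) ⊗ₜ[k] Finsupp.single l (1 : k)) := by
  simp [braid]

theorem braid_single_left (l : List ι) (c : TV k ι) :
    braid d (Finsupp.single l (1 : k) ⊗ₜ[k] c) =
      (if Even (degL d l) then c else par d c) ⊗ₜ[k] Finsupp.single l 1 := by
  suffices braid d ∘ₗ TensorProduct.mk k (TV k ι) (TV k ι) (Finsupp.single l 1) =
      (TensorProduct.mk k (TV k ι) (TV k ι)).flip (Finsupp.single l 1) ∘ₗ
        (if Even (degL d l) then LinearMap.id else par d) by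
    have h := LinearMap.congr_fun this c
    split_ifs at h ⊢ <;> exact h
  apply TV_hom_ext
  intro l'
  simp only [LinearMap.comp_apply, TensorProduct.mk_apply, braid_single, sgn_mul]
  split_ifs
  · simp
  · simp only [par_single, LinearMap.flip_apply, TensorProduct.mk_apply,
      TensorProduct.smul_tmul']

theorem braid_single_right (b : TV k ι) (l : List ι) :
    braid d (b ⊗ₜ[k] Finsupp.single l (1 : k)) =
      Finsupp.single l 1 ⊗ₜ[k] (if Even (degL d l) then b else par d b) := by
  suffices braid d ∘ₗ (TensorProduct.mk k (TV k ι) (TV k ι)).flip (Finsupp.single l 1) =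
      TensorProduct.mk k (TV k ι) (TV k ι) (Finsupp.single l 1) ∘ₗ
        (if Even (degL d l) then LinearMap.id else par d) by
    have h := LinearMap.congr_fun this b
    split_ifs at h ⊢ <;> exact h
  apply TV_hom_ext
  intro l'
  simp only [LinearMap.comp_apply, LinearMap.flip_apply, TensorProduct.mk_apply, braid_single,
    mul_comm (degL d l'), sgn_mul]
  split_ifs
  · simp
  · simp only [par_single, TensorProduct.tmul_smul]

theorem braid_odd_right {p : TV k ι} (hp : par d p = -p) (b : TV k ι) :
    braid d (b ⊗ₜ[k] p) = p ⊗ₜ[k] par d b := by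
  suffices braid d ∘ₗ (TensorProduct.mk k (TV k ι) (TV k ι)).flip p =
      (TensorProduct.mk k (TV k ι) (TV k ι) p) ∘ₗ par d from LinearMap.congr_fun this b
  apply TV_hom_ext
  intro l
  by_cases h : Even (degL d l) <;>
    simp [braid_single_left, par_single, sgn, h, hp, neg_tmul, tmul_neg]

theorem braid_even_right {p : TV k ι} (hp : par d p = p) (b : TV k ι) :
    braid d (b ⊗ₜ[k] p) = p ⊗ₜ[k] b := by
  suffices braid d ∘ₗ (TensorProduct.mk k (TV k ι) (TV k ι)).flip p =
      TensorProduct.mk k (TV k ι) (TV k ι) p from LinearMap.congr_fun this b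
  apply TV_hom_ext
  intro l
  simp [braid_single_left, hp]

theorem braid_odd_left {p : TV k ι} (hp : par d p = -p) (c : TV k ι) :
    braid d (p ⊗ₜ[k] c) = par d c ⊗ₜ[k] p := by
  suffices braid d ∘ₗ TensorProduct.mk k (TV k ι) (TV k ι) p =
      (TensorProduct.mk k (TV k ι) (TV k ι)).flip p ∘ₗ par d from LinearMap.congr_fun this c
  apply TV_hom_ext
  intro l
  by_cases h : Even (degL d l) <;>
    simp [braid_single_right, par_single, sgn, h, hp, neg_tmul, tmul_neg]

theorem braid_even_left {p : TV k ι} (hp : par d p = p) (c : TV k ι) :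
    braid d (p ⊗ₜ[k] c) = c ⊗ₜ[k] p := by
  suffices braid d ∘ₗ TensorProduct.mk k (TV k ι) (TV k ι) p =
      (TensorProduct.mk k (TV k ι) (TV k ι)).flip p from LinearMap.congr_fun this c
  apply TV_hom_ext
  intro l
  simp [braid_single_right, hp]

theorem mid_tmul_of_braid {b c b' c' : TV k ι}
    (h : braid d (b ⊗ₜ[k] c) = c' ⊗ₜ[k] b') (a e : TV k ι) :
    mid d ((a ⊗ₜ[k] b) ⊗ₜ[k] (c ⊗ₜ[k] e)) = (a ⊗ₜ[k] c') ⊗ₜ[k] (b' ⊗ₜ[k] e) := by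
  simp [mid, h]

/-- Left multiplication by `p`. -/
def lmul (mul : TV k ι ⊗[k] TV k ι →ₗ[k] TV k ι) (p : TV k ι) : TV k ι →ₗ[k] TV k ι :=
  mul ∘ₗ TensorProduct.mk k (TV k ι) (TV k ι) p

/-- Right multiplication by `p`. -/
def rmul (mul : TV k ι ⊗[k] TV k ι →ₗ[k] TV k ι) (p : TV k ι) : TV k ι →ₗ[k] TV k ι :=
  mul ∘ₗ (TensorProduct.mk k (TV k ι) (TV k ι)).flip p

@[simp]
theorem lmul_apply (mul : TV k ι ⊗[k] TV k ι →ₗ[k] TV k ι) (p x : TV k ι) :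
    lmul mul p x = mul (p ⊗ₜ[k] x) := rfl

@[simp]
theorem rmul_apply (mul : TV k ι ⊗[k] TV k ι →ₗ[k] TV k ι) (p x : TV k ι) :
    rmul mul p x = mul (x ⊗ₜ[k] p) := rfl

theorem mul_neg_tmul (mul : TV k ι ⊗[k] TV k ι →ₗ[k] TV k ι) (x y : TV k ι) :
    mul ((-x) ⊗ₜ[k] y) = -mul (x ⊗ₜ[k] y) :=
  map_neg (rmul mul y) x

theorem mul_tmul_neg (mul : TV k ι ⊗[k] TV k ι →ₗ[k] TV k ι) (x y : TV k ι) :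
    mul (x ⊗ₜ[k] (-y)) = -mul (x ⊗ₜ[k] y) :=
  map_neg (lmul mul x) y

section Multiplicative

variable {d} {mul : TV k ι ⊗[k] TV k ι →ₗ[k] TV k ι}
  (hunitl : ∀ x, mul ((ηone : TV k ι) ⊗ₜ[k] x) = x)
  (hunitr : ∀ x, mul (x ⊗ₜ[k] (ηone : TV k ι)) = x)
  (hΔmul : Δ ∘ₗ mul = (TensorProduct.map mul mul) ∘ₗ mid d ∘ₗ TensorProduct.map Δ Δ)

include hunitr hΔmul in
theorem Δ_rmul {p : TV k ι} (hp : IsPrim p) (τ : TV k ι →ₗ[k] TV k ι)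
    (hτ : ∀ b, braid d (b ⊗ₜ[k] p) = p ⊗ₜ[k] τ b) :
    Δ ∘ₗ rmul mul p =
      (TensorProduct.map (rmul mul p) τ + TensorProduct.map LinearMap.id (rmul mul p)) ∘ₗ Δ := by
  have key : ∀ t : TV k ι ⊗[k] TV k ι,
      TensorProduct.map mul mul (mid d (t ⊗ₜ[k] (p ⊗ₜ[k] ηone + ηone ⊗ₜ[k] p))) =
        TensorProduct.map (rmul mul p) τ t + TensorProduct.map LinearMap.id (rmul mul p) t := by
    intro t
    induction t with
    | zero => simp
    | add s t hs ht =>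
      rw [TensorProduct.add_tmul, map_add, map_add, hs, ht, map_add, map_add]
      abel
    | tmul a b =>
      rw [TensorProduct.tmul_add, map_add, mid_tmul_of_braid d (hτ b),
        mid_tmul_of_braid d (braid_even_right d (par_ηone d) b)]
      simp [hunitr]
  refine LinearMap.ext fun x => ?_
  have h := LinearMap.congr_fun hΔmul (x ⊗ₜ[k] p)
  simp only [LinearMap.comp_apply, LinearMap.add_apply, TensorProduct.map_tmul] at h ⊢
  rw [rmul_apply, h, hp, key]

include hunitl hΔmul in
theorem Δ_lmul {p : TV k ι} (hp : IsPrim p) (τ : TV k ι →ₗ[k] TV k ι)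
    (hτ : ∀ c, braid d (p ⊗ₜ[k] c) = τ c ⊗ₜ[k] p) :
    Δ ∘ₗ lmul mul p =
      (TensorProduct.map (lmul mul p) LinearMap.id + TensorProduct.map τ (lmul mul p)) ∘ₗ Δ := by
  have key : ∀ t : TV k ι ⊗[k] TV k ι,
      TensorProduct.map mul mul (mid d ((p ⊗ₜ[k] ηone + ηone ⊗ₜ[k] p) ⊗ₜ[k] t)) =
        TensorProduct.map (lmul mul p) LinearMap.id t + TensorProduct.map τ (lmul mul p) t := by
    intro t
    induction t with
    | zero => simp
    | add s t hs ht =>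
      rw [TensorProduct.tmul_add, map_add, map_add, hs, ht, map_add, map_add]
      abel
    | tmul a b =>
      rw [TensorProduct.add_tmul, map_add, mid_tmul_of_braid d (hτ a),
        mid_tmul_of_braid d (braid_even_left d (par_ηone d) a)]
      simp [hunitl]
  refine LinearMap.ext fun x => ?_
  have h := LinearMap.congr_fun hΔmul (p ⊗ₜ[k] x)
  simp only [LinearMap.comp_apply, LinearMap.add_apply, TensorProduct.map_tmul] at h ⊢
  rw [lmul_apply, h, hp, key]

end Multiplicative

theorem eq_zero_of_add_eq_left {t u : TV k ι ⊗[k] TV k ι} (h : t + u = t) : u = 0 := by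
  let _ : AddCommGroup (TV k ι ⊗[k] TV k ι) := Module.addCommMonoidToAddCommGroup k
  exact left_eq_add.mp h.symm

theorem tmul_add_tmul_sub (p x y : TV k ι) : p ⊗ₜ[k] x + p ⊗ₜ[k] (y - x) = p ⊗ₜ[k] y := by
  rw [← TensorProduct.tmul_add, add_sub_cancel]

theorem eq_zero_of_tmul_eq_zero_left {p v : TV k ι} (hp : p ≠ 0) (h : p ⊗ₜ[k] v = 0) :
    v = 0 := by
  obtain ⟨l, hl⟩ := Finsupp.ne_iff.mp hp
  have h' := congrArg
    (TensorProduct.lid k (TV k ι) ∘ TensorProduct.map (Finsupp.lapply l) LinearMap.id) h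
  simp only [Function.comp_apply, TensorProduct.map_tmul, TensorProduct.lid_tmul, map_zero,
    Finsupp.lapply_apply, LinearMap.id_apply] at h'
  exact (smul_eq_zero.mp h').resolve_left hl

theorem eq_zero_of_tmul_eq_zero_right {p v : TV k ι} (hp : p ≠ 0) (h : v ⊗ₜ[k] p = 0) :
    v = 0 :=
  eq_zero_of_tmul_eq_zero_left hp (by simpa using congrArg (TensorProduct.comm k _ _) h)

theorem eq_zero_of_map_comp_Δ_right {F G : TV k ι →ₗ[k] TV k ι} (hG : G ηone ≠ 0)
    (h : TensorProduct.map G F ∘ₗ Δ = 0) : F = 0 := by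
  apply TV_hom_ext
  intro l
  induction hn : l.length using Nat.strong_induction_on generalizing l with
  | _ n ih =>
    have hl := LinearMap.congr_fun h (Finsupp.single l 1)
    rw [LinearMap.comp_apply, Δ_single, map_sum, Finset.sum_range_succ',
      Finset.sum_eq_zero, zero_add] at hl
    · exact eq_zero_of_tmul_eq_zero_left hG (by simpa [ηone] using hl)
    · intro i hi
      rw [TensorProduct.map_tmul, ih _ _ (l.drop (i + 1)) rfl, LinearMap.zero_apply,
        TensorProduct.tmul_zero]
      simp only [List.length_drop, Finset.mem_range] at hi ⊢
      omega

theorem eq_zero_of_map_comp_Δ_left {F G : TV k ι →ₗ[k] TV k ι} (hG : G ηone ≠ 0)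
    (h : TensorProduct.map F G ∘ₗ Δ = 0) : F = 0 := by
  apply TV_hom_ext
  intro l
  induction hn : l.length using Nat.strong_induction_on generalizing l with
  | _ n ih =>
    have hl := LinearMap.congr_fun h (Finsupp.single l 1)
    rw [LinearMap.comp_apply, Δ_single, map_sum, Finset.sum_range_succ,
      Finset.sum_eq_zero, zero_add] at hl
    · exact eq_zero_of_tmul_eq_zero_right hG (by simpa [ηone] using hl)
    · intro i hi
      rw [TensorProduct.map_tmul, ih _ _ (l.take i) rfl, LinearMap.zero_apply,
        TensorProduct.zero_tmul]
      simp only [List.length_take, Finset.mem_range] at hi ⊢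
      omega

theorem mid_single (a b c e : List ι) :
    mid d ((Finsupp.single a (1 : k) ⊗ₜ[k] Finsupp.single b (1 : k)) ⊗ₜ[k]
        (Finsupp.single c (1 : k) ⊗ₜ[k] Finsupp.single e (1 : k))) =
      (sgn (degL d b * degL d c) : k) •
        ((Finsupp.single a (1 : k) ⊗ₜ[k] Finsupp.single c (1 : k)) ⊗ₜ[k]
          (Finsupp.single b (1 : k) ⊗ₜ[k] Finsupp.single e (1 : k))) := by
  rw [mid_tmul_of_braid d ((braid_single d b c).trans (TensorProduct.smul_tmul' _ _ _)),
    TensorProduct.tmul_smul, ← TensorProduct.smul_tmul']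

theorem eq_zero_of_map_comp_mid_Δ {F G : TV k ι ⊗[k] TV k ι →ₗ[k] TV k ι}
    (hG : G (ηone ⊗ₜ[k] ηone) ≠ 0)
    (h : TensorProduct.map G F ∘ₗ mid d ∘ₗ TensorProduct.map Δ Δ = 0) : F = 0 := by
  apply TensorProduct.ext
  apply TV_hom_ext
  intro a
  apply TV_hom_ext
  intro b
  change F (_ ⊗ₜ[k] _) = 0
  induction hn : a.length + b.length using Nat.strong_induction_on generalizing a b with
  | _ n ih =>
    have hl := LinearMap.congr_fun h (Finsupp.single a 1 ⊗ₜ[k] Finsupp.single b 1)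
    simp only [LinearMap.comp_apply, TensorProduct.map_tmul, Δ_single, TensorProduct.sum_tmul,
      TensorProduct.tmul_sum, map_sum, mid_single, map_smul, LinearMap.zero_apply] at hl
    have hterm : ∀ i ∈ Finset.range (b.length + 1), ∀ j ∈ Finset.range (a.length + 1),
        0 < i + j → F (Finsupp.single (a.drop j) 1 ⊗ₜ[k] Finsupp.single (b.drop i) 1) = 0 := by
      intro i hi j hj hij
      refine ih _ ?_ (a.drop j) (b.drop i) rfl
      simp only [List.length_drop, Finset.mem_range] at hi hj ⊢
      omega
    rw [Finset.sum_eq_single_of_mem 0 (by simp), Finset.sum_eq_single_of_mem 0 (by simp)] at hl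
    · refine eq_zero_of_tmul_eq_zero_left hG ?_
      simpa [ηone, degL, sgn] using hl
    · intro j hj hj0
      rw [hterm 0 (by simp) j hj (by omega), TensorProduct.tmul_zero, smul_zero]
    · intro i hi hi0
      refine Finset.sum_eq_zero fun j hj => ?_
      rw [hterm i hi j hj (by omega), TensorProduct.tmul_zero, smul_zero]

section OddPrimitive

variable {d} {mul : TV k ι ⊗[k] TV k ι →ₗ[k] TV k ι} {g : TV k ι}
  (hassoc : ∀ x y z, mul (mul (x ⊗ₜ[k] y) ⊗ₜ[k] z) = mul (x ⊗ₜ[k] mul (y ⊗ₜ[k] z)))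
  (hunitl : ∀ x, mul ((ηone : TV k ι) ⊗ₜ[k] x) = x)
  (hunitr : ∀ x, mul (x ⊗ₜ[k] (ηone : TV k ι)) = x)
  (hΔmul : Δ ∘ₗ mul = (TensorProduct.map mul mul) ∘ₗ mid d ∘ₗ TensorProduct.map Δ Δ)
  (hprim : IsPrim g) (hodd : par d g = -g)

include hunitl hunitr hΔmul hprim hodd

theorem isPrim_mul_self : IsPrim (mul (g ⊗ₜ[k] g)) := by
  have h := LinearMap.congr_fun (Δ_rmul hunitr hΔmul hprim _ (braid_odd_right d hodd)) g
  rw [LinearMap.comp_apply, LinearMap.comp_apply, hprim] at h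
  rw [IsPrim, ← rmul_apply, h]
  have hcancel : g ⊗ₜ[k] g + g ⊗ₜ[k] (-g) = 0 := by
    rw [← TensorProduct.tmul_add, add_neg_cancel, TensorProduct.tmul_zero]
  simp only [LinearMap.add_apply, map_add, TensorProduct.map_tmul, rmul_apply, hunitl, par_ηone,
    hodd, LinearMap.id_apply]
  rw [add_assoc, ← add_assoc (g ⊗ₜ[k] g), hcancel, zero_add]

include hassoc

/-- Right multiplication by an odd primitive element whose square is even is an odd operator. -/
theorem par_mul_odd_right (hg : g ≠ 0) (heven : par d (mul (g ⊗ₜ[k] g)) = mul (g ⊗ₜ[k] g))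
    (x : TV k ι) : par d (mul (x ⊗ₜ[k] g)) = -mul (par d x ⊗ₜ[k] g) := by
  have h1 := Δ_rmul hunitr hΔmul hprim _ (braid_odd_right d hodd)
  have h2 := Δ_rmul hunitr hΔmul (isPrim_mul_self hunitl hunitr hΔmul hprim hodd)
    LinearMap.id (braid_even_right d heven)
  have hsq : rmul mul (mul (g ⊗ₜ[k] g)) = rmul mul g ∘ₗ rmul mul g :=
    LinearMap.ext fun y => by simp [hassoc]
  have hR : par d ∘ₗ rmul mul g + rmul mul g ∘ₗ par d = 0 := by
    refine eq_zero_of_map_comp_Δ_right (G := rmul mul g) (by simpa [hunitl] using hg) ?_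
    have hexp :
        (TensorProduct.map (rmul mul g) (par d) + TensorProduct.map LinearMap.id (rmul mul g)) ∘ₗ
        (TensorProduct.map (rmul mul g) (par d) + TensorProduct.map LinearMap.id (rmul mul g)) =
        (TensorProduct.map (rmul mul g ∘ₗ rmul mul g) LinearMap.id +
          TensorProduct.map LinearMap.id (rmul mul g ∘ₗ rmul mul g)) +
          TensorProduct.map (rmul mul g) (par d ∘ₗ rmul mul g + rmul mul g ∘ₗ par d) := by
      refine TensorProduct.ext' fun a b => ?_
      simp only [LinearMap.add_apply, LinearMap.comp_apply, map_add, TensorProduct.map_tmul,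
        LinearMap.id_apply, par_par, TensorProduct.tmul_add]
      abel
    rw [hsq, ← LinearMap.comp_assoc, h1, LinearMap.comp_assoc, h1, ← LinearMap.comp_assoc,
      hexp, LinearMap.add_comp] at h2
    exact LinearMap.ext fun y => eq_zero_of_add_eq_left (LinearMap.congr_fun h2 y)
  exact eq_neg_of_add_eq_zero_left (LinearMap.congr_fun hR x)

/-- Left multiplication by an odd primitive element whose square is even is an odd operator. -/
theorem par_mul_odd_left (hg : g ≠ 0) (heven : par d (mul (g ⊗ₜ[k] g)) = mul (g ⊗ₜ[k] g))
    (x : TV k ι) : par d (mul (g ⊗ₜ[k] x)) = -mul (g ⊗ₜ[k] par d x) := by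
  have h1 := Δ_lmul hunitl hΔmul hprim _ (braid_odd_left d hodd)
  have h2 := Δ_lmul hunitl hΔmul (isPrim_mul_self hunitl hunitr hΔmul hprim hodd)
    LinearMap.id (braid_even_left d heven)
  have hsq : lmul mul (mul (g ⊗ₜ[k] g)) = lmul mul g ∘ₗ lmul mul g :=
    LinearMap.ext fun y => by simp [hassoc]
  have hL : par d ∘ₗ lmul mul g + lmul mul g ∘ₗ par d = 0 := by
    refine eq_zero_of_map_comp_Δ_left (G := lmul mul g) (by simpa [hunitr] using hg) ?_
    have hexp :
        (TensorProduct.map (lmul mul g) LinearMap.id + TensorProduct.map (par d) (lmul mul g)) ∘ₗ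
        (TensorProduct.map (lmul mul g) LinearMap.id + TensorProduct.map (par d) (lmul mul g)) =
        (TensorProduct.map (lmul mul g ∘ₗ lmul mul g) LinearMap.id +
          TensorProduct.map LinearMap.id (lmul mul g ∘ₗ lmul mul g)) +
          TensorProduct.map (par d ∘ₗ lmul mul g + lmul mul g ∘ₗ par d) (lmul mul g) := by
      refine TensorProduct.ext' fun a b => ?_
      simp only [LinearMap.add_apply, LinearMap.comp_apply, map_add, TensorProduct.map_tmul,
        LinearMap.id_apply, par_par, TensorProduct.add_tmul]
      abel
    rw [hsq, ← LinearMap.comp_assoc, h1, LinearMap.comp_assoc, h1, ← LinearMap.comp_assoc,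
      hexp, LinearMap.add_comp] at h2
    exact LinearMap.ext fun y => eq_zero_of_add_eq_left (LinearMap.congr_fun h2 y)
  exact eq_neg_of_add_eq_zero_left (LinearMap.congr_fun hL x)

/-- In the presence of a nonzero odd primitive element whose square is even, the product
preserves parity. -/
theorem par_mul (hg : g ≠ 0) (heven : par d (mul (g ⊗ₜ[k] g)) = mul (g ⊗ₜ[k] g))
    (x y : TV k ι) : par d (mul (x ⊗ₜ[k] y)) = mul (par d x ⊗ₜ[k] par d y) := by
  have hR := par_mul_odd_right hassoc hunitl hunitr hΔmul hprim hodd hg heven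
  have h1 := Δ_rmul hunitr hΔmul hprim _ (braid_odd_right d hodd)
  set ρ := rmul mul g with hρ
  set S : TV k ι ⊗[k] TV k ι →ₗ[k] TV k ι ⊗[k] TV k ι :=
    TensorProduct.map ρ (par d) + TensorProduct.map LinearMap.id ρ with hS
  set M := TensorProduct.map mul mul ∘ₗ mid d with hM
  set D : TV k ι ⊗[k] TV k ι →ₗ[k] TV k ι :=
    par d ∘ₗ mul - mul ∘ₗ TensorProduct.map (par d) (par d) with hD
  have hdefect : S ∘ₗ M = M ∘ₗ TensorProduct.map LinearMap.id S +
      TensorProduct.map (ρ ∘ₗ mul) D ∘ₗ mid d := by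
    refine TensorProduct.ext_fourfold' fun a b c e => ?_
    suffices ∀ c : TV k ι, (par d c = c ∨ par d c = -c) →
        (S ∘ₗ M) ((a ⊗ₜ[k] b) ⊗ₜ[k] (c ⊗ₜ[k] e)) =
          (M ∘ₗ TensorProduct.map LinearMap.id S + TensorProduct.map (ρ ∘ₗ mul) D ∘ₗ mid d)
            ((a ⊗ₜ[k] b) ⊗ₜ[k] (c ⊗ₜ[k] e)) by
      induction c using Finsupp.induction_linear with
      | zero => simp
      | add f f' hf hf' =>
        rw [TensorProduct.add_tmul, TensorProduct.tmul_add, map_add, map_add, hf, hf']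
      | single l r =>
        refine this _ ?_
        rw [← mul_one r, ← smul_eq_mul, ← Finsupp.smul_single, map_smul, par_single, sgn]
        split_ifs <;> simp
    rintro c (hc | hc)
    · have hρc : par d (mul (c ⊗ₜ[k] g)) = -mul (c ⊗ₜ[k] g) := by rw [hR, hc]
      simp only [hS, hM, hD, hρ, LinearMap.sub_apply, LinearMap.add_apply, LinearMap.comp_apply,
        TensorProduct.map_tmul, LinearMap.id_apply, TensorProduct.tmul_add, map_add,
        mid_tmul_of_braid d (braid_even_right d hc b), rmul_apply,
        mid_tmul_of_braid d (braid_odd_right d hρc b), hassoc]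
      rw [add_right_comm, tmul_add_tmul_sub]
    · have hρc : par d (mul (c ⊗ₜ[k] g)) = mul (c ⊗ₜ[k] g) := by
        rw [hR, hc, mul_neg_tmul, neg_neg]
      simp only [hS, hM, hD, hρ, LinearMap.sub_apply, LinearMap.add_apply, LinearMap.comp_apply,
        TensorProduct.map_tmul, LinearMap.id_apply, TensorProduct.tmul_add, map_add,
        mid_tmul_of_braid d (braid_odd_right d hc b), rmul_apply, par_par,
        mid_tmul_of_braid d (braid_even_right d hρc b), hassoc]
      rw [add_right_comm, tmul_add_tmul_sub]
  have hρmul : ρ ∘ₗ mul = mul ∘ₗ TensorProduct.map LinearMap.id ρ :=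
    TensorProduct.ext' fun a b => by simp [hρ, hassoc]
  have hmap : TensorProduct.map (Δ : TV k ι →ₗ[k] _) (Δ : TV k ι →ₗ[k] _) ∘ₗ
      TensorProduct.map LinearMap.id ρ =
      TensorProduct.map LinearMap.id S ∘ₗ TensorProduct.map Δ Δ := by
    rw [← TensorProduct.map_comp, ← TensorProduct.map_comp, h1]
    rfl
  have hD0 : D = 0 := by
    refine eq_zero_of_map_comp_mid_Δ d (G := ρ ∘ₗ mul) (by simpa [hρ, hunitl] using hg) ?_
    have hcomp : (S ∘ₗ M) ∘ₗ TensorProduct.map Δ Δ =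
        (M ∘ₗ TensorProduct.map LinearMap.id S) ∘ₗ TensorProduct.map Δ Δ := by
      calc (S ∘ₗ M) ∘ₗ TensorProduct.map Δ Δ = S ∘ₗ Δ ∘ₗ mul := by
            rw [hΔmul]; rfl
        _ = Δ ∘ₗ ρ ∘ₗ mul := by rw [← LinearMap.comp_assoc, ← h1]; rfl
        _ = (M ∘ₗ TensorProduct.map Δ Δ) ∘ₗ TensorProduct.map LinearMap.id ρ := by
            rw [hρmul, ← LinearMap.comp_assoc, hΔmul]; rfl
        _ = (M ∘ₗ TensorProduct.map LinearMap.id S) ∘ₗ TensorProduct.map Δ Δ := by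
            rw [LinearMap.comp_assoc, hmap]; rfl
    rw [hdefect, LinearMap.add_comp] at hcomp
    refine LinearMap.ext fun t => ?_
    exact eq_zero_of_add_eq_left (LinearMap.congr_fun hcomp t)
  exact sub_eq_zero.mp (LinearMap.congr_fun hD0 (x ⊗ₜ[k] y))

end OddPrimitive

/-- A degree-one coderivation of the tensor coalgebra. -/
def IsCoder (f : TV k ι →ₗ[k] TV k ι) : Prop :=
  Δ ∘ₗ f = (TensorProduct.map f LinearMap.id + TensorProduct.map (par d) f) ∘ₗ Δ

variable {d}

theorem IsCoder.add {f f' : TV k ι →ₗ[k] TV k ι} (hf : IsCoder d f) (hf' : IsCoder d f') :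
    IsCoder d (f + f') := by
  unfold IsCoder at *
  rw [LinearMap.comp_add, hf, hf', ← LinearMap.add_comp, TensorProduct.map_add_left,
    TensorProduct.map_add_right, add_add_add_comm]

theorem IsCoder.smul {f : TV k ι →ₗ[k] TV k ι} (c : k) (hf : IsCoder d f) :
    IsCoder d (c • f) := by
  unfold IsCoder at *
  rw [LinearMap.comp_smul, hf, TensorProduct.map_smul_left, TensorProduct.map_smul_right,
    ← smul_add, LinearMap.smul_comp]

end BInfty

/-- **Twisting of a `B_∞`-algebra by a Maurer–Cartan element.** Let `(V, d, m)` be a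
`B_∞`-algebra, i.e. `(T(V), m, Δ, η, ε, d)` is a DG bialgebra with `Δ` the deconcatenation
coproduct. If `γ ∈ V` has degree `1` and satisfies the Maurer–Cartan equation
`d(γ) + m(γ ⊗ γ) = 0` (equivalently `d₁(γ) + m_{1,1}(γ ⊗ γ) = 0`, as `γ` is primitive), then
`d_γ := d + m(γ ⊗ -) - m(- ⊗ γ)` (with Koszul signs) squares to zero, is a derivation for `m`
and a coderivation for `Δ`, so `(T(V), m, Δ, η, ε, d_γ)` is again a DG bialgebra. -/
theorem BInfty_twist_by_MaurerCartan
    (k ι : Type) [Field k] [CharZero k] (d : ι → ℤ)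
    (mul : TV k ι ⊗[k] TV k ι →ₗ[k] TV k ι) (dd : TV k ι →ₗ[k] TV k ι)
    -- `m` is associative and unital
    (hassoc : mul ∘ₗ TensorProduct.map mul LinearMap.id =
      (mul ∘ₗ TensorProduct.map LinearMap.id mul) ∘ₗ
        (TensorProduct.assoc k (TV k ι) (TV k ι) (TV k ι)).toLinearMap)
    (hunitl : ∀ x, mul ((ηone : TV k ι) ⊗ₜ[k] x) = x)
    (hunitr : ∀ x, mul (x ⊗ₜ[k] (ηone : TV k ι)) = x)
    -- `m` is a morphism of coalgebras
    (hΔmul : Δ ∘ₗ mul = (TensorProduct.map mul mul) ∘ₗ mid d ∘ₗ TensorProduct.map Δ Δ)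
    (hεmul : ∀ x y : TV k ι, ε (mul (x ⊗ₜ[k] y)) = ε x * ε y)
    -- `d` is a square-zero degree-one derivation and coderivation
    (hd2 : dd ∘ₗ dd = 0)
    (hder : dd ∘ₗ mul =
      mul ∘ₗ (TensorProduct.map dd LinearMap.id + TensorProduct.map (par d) dd))
    (hcoder : Δ ∘ₗ dd =
      (TensorProduct.map dd LinearMap.id + TensorProduct.map (par d) dd) ∘ₗ Δ)
    (hεd : ε ∘ₗ dd = 0)
    (hdpar : dd ∘ₗ par d = - (par d ∘ₗ dd))
    -- a degree-one Maurer–Cartan element `γ ∈ V ⊂ T(V)`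
    (γ : ι →₀ k) (hγdeg : ∀ i ∈ γ.support, d i = 1)
    (hMC : dd (embV γ) + mul (embV γ ⊗ₜ[k] embV γ) = 0) :
    -- the twisted coderivation `d_γ = d + m(γ ⊗ -) - m(- ⊗ γ)` (with Koszul signs)
    ∀ dγ : TV k ι →ₗ[k] TV k ι,
      dγ = dd + mul ∘ₗ (TensorProduct.mk k (TV k ι) (TV k ι) (embV γ))
            - mul ∘ₗ ((TensorProduct.mk k (TV k ι) (TV k ι)).flip (embV γ)) ∘ₗ par d →
      -- `d_γ` squares to zero, ...
      dγ ∘ₗ dγ = 0 ∧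
      -- ... is a derivation with respect to `m`, ...
      dγ ∘ₗ mul =
        mul ∘ₗ (TensorProduct.map dγ LinearMap.id + TensorProduct.map (par d) dγ) ∧
      -- ... and a coderivation with respect to `Δ`
      Δ ∘ₗ dγ =
        (TensorProduct.map dγ LinearMap.id + TensorProduct.map (par d) dγ) ∘ₗ Δ := by
  rintro dγ rfl
  by_cases hg : embV γ = 0
  · have hdd : dd + mul ∘ₗ (TensorProduct.mk k (TV k ι) (TV k ι) (embV γ))
        - mul ∘ₗ ((TensorProduct.mk k (TV k ι) (TV k ι)).flip (embV γ)) ∘ₗ par d = dd :=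
      LinearMap.ext fun x => by simp [hg]
    rw [hdd]
    exact ⟨hd2, hder, hcoder⟩
  have hassoc' : ∀ x y z, mul (mul (x ⊗ₜ[k] y) ⊗ₜ[k] z) = mul (x ⊗ₜ[k] mul (y ⊗ₜ[k] z)) :=
    fun x y z => LinearMap.congr_fun hassoc ((x ⊗ₜ[k] y) ⊗ₜ[k] z)
  have hd2' : ∀ x, dd (dd x) = 0 := LinearMap.congr_fun hd2
  have hder' : ∀ x y, dd (mul (x ⊗ₜ[k] y)) = mul (dd x ⊗ₜ[k] y) + mul (par d x ⊗ₜ[k] dd y) :=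
    fun x y => by simpa using LinearMap.congr_fun hder (x ⊗ₜ[k] y)
  have hdpar' : ∀ x, dd (par d x) = -par d (dd x) := LinearMap.congr_fun hdpar
  have hprim := isPrim_embV γ
  have hodd := par_embV d hγdeg
  have hMC' := eq_neg_of_add_eq_zero_left hMC
  generalize embV γ = g at *
  have heven : par d (mul (g ⊗ₜ[k] g)) = mul (g ⊗ₜ[k] g) := by
    have h := hdpar' g
    rw [hodd, map_neg, hMC', map_neg, neg_neg, neg_neg] at h
    exact h.symm
  have hR := par_mul_odd_right hassoc' hunitl hunitr hΔmul hprim hodd hg heven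
  have hL := par_mul_odd_left hassoc' hunitl hunitr hΔmul hprim hodd hg heven
  have hD := par_mul hassoc' hunitl hunitr hΔmul hprim hodd hg heven
  refine ⟨LinearMap.ext fun x => ?_, TensorProduct.ext' fun x y => ?_, ?_⟩
  · simp only [LinearMap.comp_apply, LinearMap.add_apply, LinearMap.sub_apply, map_add, map_sub,
      TensorProduct.mk_apply, LinearMap.flip_apply, hd2', hder', hMC', hodd, hdpar', hL, hR,
      par_par, mul_neg_tmul, mul_tmul_neg, map_neg, hassoc',
      LinearMap.zero_apply]
    abel
  · simp only [LinearMap.comp_apply, LinearMap.add_apply, LinearMap.sub_apply, map_add, map_sub,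
      TensorProduct.mk_apply, LinearMap.flip_apply, TensorProduct.map_tmul, LinearMap.id_apply,
      hder', hD, hassoc', TensorProduct.tmul_add, TensorProduct.tmul_sub, TensorProduct.add_tmul,
      TensorProduct.sub_tmul]
    abel
  · have hΔl := Δ_lmul hunitl hΔmul hprim _ (braid_odd_left d hodd)
    have hΔr : IsCoder d (rmul mul g ∘ₗ par d) := by
      have h := Δ_rmul hunitr hΔmul hprim _ (braid_odd_right d hodd)
      rw [IsCoder, ← LinearMap.comp_assoc, h, LinearMap.comp_assoc, Δ_comp_par,
        ← LinearMap.comp_assoc, LinearMap.add_comp, ← TensorProduct.map_comp,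
        ← TensorProduct.map_comp, par_comp_par, LinearMap.id_comp]
    have hE : dd + mul ∘ₗ (TensorProduct.mk k (TV k ι) (TV k ι) g)
        - mul ∘ₗ ((TensorProduct.mk k (TV k ι) (TV k ι)).flip g) ∘ₗ par d =
        dd + lmul mul g + (-1 : k) • (rmul mul g ∘ₗ par d) :=
      LinearMap.ext fun x => by simp [sub_eq_add_neg]
    rw [hE]
    exact (IsCoder.add (d := d) hcoder hΔl).add (hΔr.smul (-1))
end
end

section
/- (Kontsevich vanishing lemma) For n ≥ 3, the integral over the compactified configuration space C_n of any wedge product of 2n−3 one-forms ω_{i_α j_α} (pullbacks via the projections π_{ij} : C_n → C₂ of the angle form dφ on C₂) vanishes: ∫_{C_n} ⋀_{α=1}^{2n−3} ω_{i_α j_α} = 0. -/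
open MeasureTheory

noncomputable section

/-- extend a `Fin N`-tuple of reals to `ℕ` by `0`. -/
def padR {N : ℕ} (u : Fin N → ℝ) : ℕ → ℝ := fun t => if h : t < N then u ⟨t, h⟩ else 0

/-- the positions of `n` points in the plane, in the standard gauge-fixed
parametrization of the `(2n-3)`-dimensional configuration space `C_n`
(first point at `0`, second point on the unit circle). -/
def confPt (n : ℕ) (u : Fin (2 * n - 3) → ℝ) (j : Fin n) : ℂ :=
  if j.1 = 0 then 0
  else if j.1 = 1 then Complex.exp (Complex.I * (padR u 0 : ℝ))
  else (padR u (2 * j.1 - 3) : ℂ) + Complex.I * (padR u (2 * j.1 - 2) : ℝ)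

section DegreeZero

open scoped Pointwise

variable {E : Type*} [NormedAddCommGroup E] [NormedSpace ℝ E] [FiniteDimensional ℝ E]

/-- The coefficients of the characteristic polynomial depend continuously on the endomorphism. -/
lemma continuous_charpoly_coeff (i : ℕ) :
    Continuous fun A : E →L[ℝ] E => (A : E →ₗ[ℝ] E).charpoly.coeff i := by
  let b := Module.finBasis ℝ E
  have key : ∀ A : E →L[ℝ] E, (A : E →ₗ[ℝ] E).charpoly.coeff i =
      MvPolynomial.eval (fun p : _ × _ => LinearMap.toMatrix b b (A : E →ₗ[ℝ] E) p.1 p.2)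
        ((Matrix.charpoly.univ ℝ (Fin (Module.finrank ℝ E))).coeff i) := by
    intro A
    rw [← LinearMap.charpoly_toMatrix _ b]
    have h := Matrix.charpoly.univ_coeff_eval₂Hom (Fin (Module.finrank ℝ E)) (RingHom.id ℝ)
      (fun p => LinearMap.toMatrix b b (A : E →ₗ[ℝ] E) p.1 p.2) i
    rw [MvPolynomial.coe_eval₂Hom, MvPolynomial.eval₂_id] at h
    rw [h]
    congr 2
  simp_rw [key]
  refine (MvPolynomial.continuous_eval _).comp (continuous_pi fun p => ?_)
  simp only [LinearMap.toMatrix_apply]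
  have h1 : Continuous fun A : E →L[ℝ] E => A (b p.2) :=
    (ContinuousLinearMap.apply ℝ E (b p.2)).continuous
  exact (b.coord p.1).continuous_of_finiteDimensional.comp h1

/-- A large multiple of the identity minus a compactly supported `C¹` map scales the volume of a
ball containing the support as the multiple of the identity does. -/
lemma exists_forall_setIntegral_charpoly_eval_fderiv [MeasurableSpace E] [BorelSpace E]
    (μ : Measure E) [μ.IsAddHaarMeasure] {F : E → E} (hF : ContDiff ℝ 1 F)
    (hc : HasCompactSupport F) {r : ℝ} (hr : tsupport F ⊆ Metric.closedBall 0 r) :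
    ∃ s₀ : ℝ, ∀ s > s₀,
      ∫ x in Metric.closedBall (0 : E) r, ((fderiv ℝ F x : E →ₗ[ℝ] E).charpoly.eval s) ∂μ
        = s ^ Module.finrank ℝ E * μ.real (Metric.closedBall 0 r) := by
  obtain ⟨K, hK⟩ := ContDiff.lipschitzWith_of_hasCompactSupport hc hF (by simp)
  obtain ⟨δ, hδ, hpos⟩ : ∃ δ > 0, ∀ A : E →L[ℝ] E, ‖A‖ < δ → 0 < (1 - A).det := by
    have hcont : Continuous fun A : E →L[ℝ] E => (1 - A).det :=
      ContinuousLinearMap.continuous_det.comp (continuous_const.sub continuous_id)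
    have h0 : 0 < ((1 : E →L[ℝ] E) - 0).det := by simp [ContinuousLinearMap.det]
    obtain ⟨δ, hδ, h⟩ := Metric.eventually_nhds_iff.1 ((hcont.tendsto 0).eventually_const_lt h0)
    exact ⟨δ, hδ, fun A hA => h (by simpa using hA)⟩
  refine ⟨max (K / δ) K, fun s hs => ?_⟩
  have hsK : (K : ℝ) < s := lt_of_le_of_lt (le_max_right _ _) hs
  have hs0 : 0 < s := lt_of_le_of_lt K.2 hsK
  have hsδ : K / s < δ := by
    rw [div_lt_iff₀ hs0, mul_comm, ← div_lt_iff₀ hδ]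
    exact lt_of_le_of_lt (le_max_left _ _) hs
  set G : E → E := fun x => s • x - F x with hG
  have hd : ∀ x, HasFDerivAt G (s • (1 : E →L[ℝ] E) - fderiv ℝ F x) x := fun x =>
    ((hasFDerivAt_id x).const_smul s).sub (hF.differentiable (by simp) x).hasFDerivAt
  have hdet : ∀ x, (fderiv ℝ F x : E →ₗ[ℝ] E).charpoly.eval s
      = (s • (1 : E →L[ℝ] E) - fderiv ℝ F x).det := by
    intro x
    rw [LinearMap.eval_charpoly, ContinuousLinearMap.det]
    congr 1
  have hdet0 : ∀ x, 0 ≤ (s • (1 : E →L[ℝ] E) - fderiv ℝ F x).det := by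
    intro x
    have e1 : s • (1 : E →L[ℝ] E) - fderiv ℝ F x = s • (1 - s⁻¹ • fderiv ℝ F x) := by
      rw [smul_sub, smul_smul, mul_inv_cancel₀ hs0.ne', one_smul]
    have e2 : (s • (1 - s⁻¹ • fderiv ℝ F x)).det
        = s ^ Module.finrank ℝ E * (1 - s⁻¹ • fderiv ℝ F x).det := by
      simp only [ContinuousLinearMap.det, ContinuousLinearMap.toLinearMap_smul, LinearMap.det_smul]
    rw [e1, e2]
    refine mul_nonneg (by positivity) (hpos _ ?_).le
    rw [norm_smul, norm_inv, Real.norm_of_nonneg hs0.le, inv_mul_eq_div]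
    refine lt_of_le_of_lt ?_ hsδ
    gcongr
    exact norm_fderiv_le_of_lipschitz ℝ hK
  have hinj : Function.Injective G := by
    intro x y hxy
    by_contra hne
    have h1 : s • (x - y) = F x - F y := by
      simp only [hG] at hxy
      rw [smul_sub, sub_eq_sub_iff_add_eq_add, add_comm (F x)]
      rw [sub_eq_sub_iff_add_eq_add] at hxy
      rw [hxy, add_comm]
    have h2 := hK.dist_le_mul x y
    rw [dist_eq_norm, ← h1, norm_smul, Real.norm_of_nonneg hs0.le, dist_eq_norm] at h2
    have h3 : 0 < ‖x - y‖ := norm_pos_iff.2 (sub_ne_zero.2 hne)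
    exact absurd (le_of_mul_le_mul_right h2 h3) (not_le.2 hsK)
  have hsurj : Function.Surjective G := by
    intro y
    let f : E → E := fun x => s⁻¹ • (y + F x)
    have hlip : LipschitzWith (Real.toNNReal s⁻¹ * K) f := by
      refine LipschitzWith.of_dist_le_mul fun a b => ?_
      simp only [f, dist_eq_norm, ← smul_sub, add_sub_add_left_eq_sub, norm_smul, norm_inv,
        Real.norm_of_nonneg hs0.le, NNReal.coe_mul, Real.coe_toNNReal _ (inv_nonneg.2 hs0.le),
        mul_assoc]
      gcongr
      simpa [dist_eq_norm] using hK.dist_le_mul a b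
    have hcw : ContractingWith (Real.toNNReal s⁻¹ * K) f := by
      refine ⟨?_, hlip⟩
      rw [← NNReal.coe_lt_coe, NNReal.coe_mul, Real.coe_toNNReal _ (inv_nonneg.2 hs0.le),
        inv_mul_eq_div, NNReal.coe_one, div_lt_one hs0]
      exact hsK
    have hfix : f (hcw.fixedPoint f) = hcw.fixedPoint f := hcw.fixedPoint_isFixedPt
    refine ⟨hcw.fixedPoint f, ?_⟩
    have : s • f (hcw.fixedPoint f) = y + F (hcw.fixedPoint f) := by
      simp only [f]
      rw [smul_smul, mul_inv_cancel₀ hs0.ne', one_smul]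
    rw [hfix] at this
    simp only [hG, this, add_sub_cancel_right]
  have hout : ∀ x ∉ Metric.closedBall (0 : E) r, G x = s • x := by
    intro x hx
    have : F x = 0 := image_eq_zero_of_notMem_tsupport fun h => hx (hr h)
    simp [hG, this]
  have himg : μ (G '' Metric.closedBall (0 : E) r) = μ (s • Metric.closedBall (0 : E) r) := by
    have hcompl : G '' (Metric.closedBall (0 : E) r)ᶜ =
        (fun x => s • x) '' (Metric.closedBall (0 : E) r)ᶜ := Set.image_congr hout
    rw [Set.image_compl_eq ⟨hinj, hsurj⟩, Set.image_compl_eq (MulAction.bijective₀ hs0.ne')]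
      at hcompl
    rw [compl_injective hcompl, Set.image_smul]
  have hcv := integral_image_eq_integral_abs_det_fderiv_smul μ
    (measurableSet_closedBall (x := (0 : E)) (ε := r)) (fun x _ => (hd x).hasFDerivWithinAt)
    hinj.injOn (fun _ => (1 : ℝ))
  simp only [smul_eq_mul, mul_one, abs_of_nonneg (hdet0 _)] at hcv
  simp only [hdet]
  rw [← hcv, integral_const, smul_eq_mul, mul_one, measureReal_restrict_apply_univ, measureReal_def,
    himg, Measure.addHaar_smul_of_nonneg _ hs0.le, ENNReal.toReal_mul,
    ENNReal.toReal_ofReal (by positivity), measureReal_def]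

/-- The Jacobian determinant of a compactly supported `C¹` map has vanishing integral. -/
theorem integral_det_fderiv_eq_zero [MeasurableSpace E] [BorelSpace E] [Nontrivial E]
    (μ : Measure E) [μ.IsAddHaarMeasure] {F : E → E} (hF : ContDiff ℝ 1 F)
    (hc : HasCompactSupport F) : ∫ x, (fderiv ℝ F x).det ∂μ = 0 := by
  obtain ⟨r, hr⟩ := hc.isCompact.isBounded.subset_closedBall (0 : E)
  obtain ⟨s₀, hs⟩ := exists_forall_setIntegral_charpoly_eval_fderiv μ hF hc hr
  set m := Module.finrank ℝ E
  have hm : 0 < m := Module.finrank_pos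
  set B := Metric.closedBall (0 : E) r
  let p : Polynomial ℝ := ∑ i ∈ Finset.range (m + 1),
    Polynomial.monomial i (∫ x in B, (fderiv ℝ F x : E →ₗ[ℝ] E).charpoly.coeff i ∂μ)
  have hcoeff : ∀ i, IntegrableOn (fun x => (fderiv ℝ F x : E →ₗ[ℝ] E).charpoly.coeff i) B μ :=
    fun i => (((continuous_charpoly_coeff i).comp
      (hF.continuous_fderiv (by simp))).continuousOn).integrableOn_compact
        (isCompact_closedBall _ _)
  have hp : p = Polynomial.monomial m (μ.real B) := by
    refine Polynomial.eq_of_infinite_eval_eq _ _ ((Set.Ioi_infinite s₀).mono fun s hs' => ?_)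
    have h1 := hs s hs'
    simp only [Set.mem_ofPred_eq, p, Polynomial.eval_finsetSum, Polynomial.eval_monomial]
    rw [mul_comm (μ.real B), ← h1]
    have h2 : ∀ x, (fderiv ℝ F x : E →ₗ[ℝ] E).charpoly.eval s
        = ∑ i ∈ Finset.range (m + 1), (fderiv ℝ F x : E →ₗ[ℝ] E).charpoly.coeff i * s ^ i := by
      intro x
      rw [Polynomial.eval_eq_sum_range, LinearMap.charpoly_natDegree]
    simp only [h2]
    rw [integral_finsetSum _ fun i _ => (hcoeff i).mul_const _]
    simp only [integral_mul_const]
  have h0 : ∫ x in B, (fderiv ℝ F x : E →ₗ[ℝ] E).charpoly.coeff 0 ∂μ = 0 := by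
    have h1 := congrArg (fun q => Polynomial.coeff q 0) hp
    simp only [p, Polynomial.finsetSum_coeff, Polynomial.coeff_monomial] at h1
    simpa [hm.ne'] using h1
  have hdet : ∀ x, (fderiv ℝ F x).det
      = (-1) ^ m * (fderiv ℝ F x : E →ₗ[ℝ] E).charpoly.coeff 0 := fun x =>
    LinearMap.det_eq_sign_charpoly_coeff _
  rw [← setIntegral_eq_integral_of_forall_compl_eq_zero (s := B)]
  · simp only [hdet]
    rw [integral_const_mul, h0, mul_zero]
  · intro x hx
    have : fderiv ℝ F x = 0 := image_eq_zero_of_notMem_tsupport fun h =>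
      hx (hr (tsupport_fderiv_subset ℝ h))
    rw [this, ContinuousLinearMap.det, ContinuousLinearMap.toLinearMap_zero, LinearMap.det_zero,
      zero_pow hm.ne']

end DegreeZero

section Configurations

variable {N : ℕ}

/-- The real coordinates of `N` points of the plane. -/
def planeCoords (N : ℕ) : (Fin (2 * N) → ℝ) ≃ₗ[ℝ] (Fin N → ℂ) where
  toFun x k := ⟨x ⟨2 * k, by omega⟩, x ⟨2 * k + 1, by omega⟩⟩
  invFun z i := if i.1 % 2 = 0 then (z ⟨i / 2, by omega⟩).re else (z ⟨i / 2, by omega⟩).im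
  map_add' x y := funext fun k => by apply Complex.ext <;> simp
  map_smul' a x := funext fun k => by apply Complex.ext <;> simp
  left_inv x := by
    ext i
    by_cases h : i.1 % 2 = 0
    · simp only [h, if_true]
      congr 1
      ext
      simp only
      omega
    · simp only [h, if_false]
      congr 1
      ext
      simp only
      omega
  right_inv z := by
    funext k
    apply Complex.ext
    · simp
    · have h1 : ((2 * k.1 + 1) % 2) = 1 := by omega
      have h2 : ((2 * k.1 + 1) / 2) = k.1 := by omega
      simp [h1, h2]

/-- The determinant of `2 * N` real linear forms on `ℂ ^ N` in the real coordinates. -/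
def formDet (A : Fin (2 * N) → (Fin N → ℂ) →ₗ[ℝ] ℝ) : ℝ :=
  Matrix.det (Matrix.of fun α β => A α (planeCoords N (Pi.single β 1)))

lemma formDet_comp (A : Fin (2 * N) → (Fin N → ℂ) →ₗ[ℝ] ℝ)
    (T : (Fin N → ℂ) →ₗ[ℝ] (Fin N → ℂ)) :
    formDet (fun α => A α ∘ₗ T) = formDet A * LinearMap.det T := by
  let b := (Pi.basisFun ℝ (Fin (2 * N))).map (planeCoords N)
  have hb : ∀ β, b β = planeCoords N (Pi.single β 1) := fun β => by simp [b]
  rw [← LinearMap.det_toMatrix b T, formDet, formDet, ← Matrix.det_mul]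
  congr 1
  ext α β
  simp only [Matrix.of_apply, Matrix.mul_apply, LinearMap.toMatrix_apply, ← hb, LinearMap.comp_apply]
  conv_lhs => rw [← b.sum_repr (T (b β)), map_sum]
  simp [mul_comm]

lemma formDet_smul (s : Fin (2 * N) → ℝ) (A : Fin (2 * N) → (Fin N → ℂ) →ₗ[ℝ] ℝ) :
    formDet (fun α => s α • A α) = (∏ α, s α) * formDet A :=
  Matrix.det_mul_column s (Matrix.of fun α β => A α (planeCoords N (Pi.single β 1)))

lemma formDet_eq_zero_of_eq_zero {A : Fin (2 * N) → (Fin N → ℂ) →ₗ[ℝ] ℝ} (α : Fin (2 * N))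
    (h : A α = 0) : formDet A = 0 :=
  Matrix.det_eq_zero_of_row_eq_zero α fun β => by simp [h]

lemma formDet_eq_zero_of_apply_eq_zero {A : Fin (2 * N) → (Fin N → ℂ) →ₗ[ℝ] ℝ}
    {v : Fin N → ℂ} (hv : v ≠ 0) (h : ∀ α, A α v = 0) : formDet A = 0 := by
  rw [formDet, ← Matrix.exists_mulVec_eq_zero_iff]
  refine ⟨(planeCoords N).symm v, by simpa using hv, ?_⟩
  ext α
  have h1 := h α
  rw [← (planeCoords N).apply_symm_apply v,
    ← (Pi.basisFun ℝ (Fin (2 * N))).sum_repr ((planeCoords N).symm v), map_sum, map_sum] at h1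
  simpa [Matrix.mulVec, dotProduct, mul_comm] using h1

lemma det_eq_formDet (T : (Fin N → ℂ) →ₗ[ℝ] (Fin N → ℂ)) :
    LinearMap.det T =
      formDet fun α => LinearMap.proj α ∘ₗ (planeCoords N).symm.toLinearMap ∘ₗ T := by
  have h := formDet_comp (fun α => LinearMap.proj α ∘ₗ (planeCoords N).symm.toLinearMap) T
  have h1 : formDet (fun α : Fin (2 * N) =>
      (LinearMap.proj α ∘ₗ (planeCoords N).symm.toLinearMap : (Fin N → ℂ) →ₗ[ℝ] ℝ)) = 1 := by
    rw [formDet, ← Matrix.det_one (n := Fin (2 * N)) (R := ℝ)]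
    congr 1
    ext α β
    simp [Matrix.one_apply, Pi.single_apply]
  rw [h1, one_mul] at h
  exact h.symm

lemma det_restrictScalars_nonneg (T : (Fin N → ℂ) →ₗ[ℂ] (Fin N → ℂ)) :
    0 ≤ LinearMap.det (T.restrictScalars ℝ) := by
  rw [LinearMap.det_restrictScalars, Algebra.norm_complex_apply]
  exact Complex.normSq_nonneg _

/-- The imaginary parts of complex linear forms have determinant proportional to that of their
real parts. -/
lemma formDet_im (A : Fin (2 * N) → (Fin N → ℂ) →ₗ[ℂ] ℂ) :
    formDet (fun α => Complex.imLm ∘ₗ (A α).restrictScalars ℝ) =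
      formDet (fun α => Complex.reLm ∘ₗ (A α).restrictScalars ℝ) *
        LinearMap.det (((-Complex.I) • (1 : (Fin N → ℂ) →ₗ[ℂ] (Fin N → ℂ))).restrictScalars ℝ) := by
  rw [← formDet_comp]
  congr 1
  ext α v
  simp

/-- The configuration with first point `0`, second point `c` and remaining points `x`. -/
def conf (c : ℂ) (x : Fin N → ℂ) : Fin (N + 2) → ℂ := Matrix.vecCons 0 (Matrix.vecCons c x)

@[simp] lemma conf_zero (c : ℂ) (x : Fin N → ℂ) : conf c x 0 = 0 := rfl

@[simp] lemma conf_one (c : ℂ) (x : Fin N → ℂ) : conf c x 1 = c := rfl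

@[simp] lemma conf_succ_succ (c : ℂ) (x : Fin N → ℂ) (k : Fin N) : conf c x k.succ.succ = x k := rfl

lemma forall_fin_add_two {p : Fin (N + 2) → Prop} :
    (∀ k, p k) ↔ p 0 ∧ p 1 ∧ ∀ k : Fin N, p k.succ.succ := by
  rw [Fin.forall_fin_succ, Fin.forall_fin_succ]
  rfl

lemma conf_add (c d : ℂ) (x y : Fin N → ℂ) (k : Fin (N + 2)) :
    conf (c + d) (x + y) k = conf c x k + conf d y k := by
  revert k
  simp [forall_fin_add_two]

lemma conf_smul (a c : ℂ) (x : Fin N → ℂ) (k : Fin (N + 2)) :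
    conf (a * c) (a • x) k = a * conf c x k := by
  revert k
  simp [forall_fin_add_two]

/-- The derivative of the `k`-th point of a configuration. -/
def pointForm (k : Fin (N + 2)) : (Fin N → ℂ) →L[ℂ] ℂ :=
  LinearMap.toContinuousLinearMap
    { toFun := fun v => conf 0 v k
      map_add' := fun v w => by simpa using conf_add 0 0 v w k
      map_smul' := fun a v => by simpa using conf_smul a 0 v k }

lemma pointForm_apply (k : Fin (N + 2)) (v : Fin N → ℂ) : pointForm k v = conf 0 v k := rfl

lemma conf_eq_add_pointForm (c : ℂ) (x : Fin N → ℂ) (k : Fin (N + 2)) :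
    conf c x k = conf c 0 k + pointForm k x := by
  rw [pointForm_apply, ← conf_add, add_zero, zero_add]

lemma hasFDerivAt_conf (c : ℂ) (k : Fin (N + 2)) (x : Fin N → ℂ) :
    HasFDerivAt (fun y => conf c y k) (pointForm k) x := by
  rw [funext fun y => conf_eq_add_pointForm c y k]
  exact (pointForm k).hasFDerivAt.const_add _

lemma contDiff_conf (c : ℂ) (k : Fin (N + 2)) : ContDiff ℝ 1 fun y : Fin N → ℂ => conf c y k := by
  rw [funext fun y => conf_eq_add_pointForm c y k]
  exact contDiff_const.add ((pointForm k).restrictScalars ℝ).contDiff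

lemma continuous_conf (c : ℂ) (k : Fin (N + 2)) : Continuous fun y : Fin N → ℂ => conf c y k :=
  (contDiff_conf c k).continuous

/-- The separation vector along the edge `a`. -/
def edge (c : ℂ) (a : Fin (N + 2) × Fin (N + 2)) (x : Fin N → ℂ) : ℂ :=
  conf c x a.2 - conf c x a.1

/-- The derivative of the separation vector along the edge `a`. -/
def edgeForm (a : Fin (N + 2) × Fin (N + 2)) : (Fin N → ℂ) →L[ℂ] ℂ :=
  pointForm a.2 - pointForm a.1

/-- The logarithmic derivative of the separation vector along the edge `a`. -/
def logForm (c : ℂ) (a : Fin (N + 2) × Fin (N + 2)) (x : Fin N → ℂ) : (Fin N → ℂ) →L[ℂ] ℂ :=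
  (edge c a x)⁻¹ • edgeForm a

lemma hasFDerivAt_edge (c : ℂ) (a : Fin (N + 2) × Fin (N + 2)) (x : Fin N → ℂ) :
    HasFDerivAt (edge c a) (edgeForm a) x :=
  (hasFDerivAt_conf c a.2 x).sub (hasFDerivAt_conf c a.1 x)

lemma edge_eq_add_edgeForm (c : ℂ) (a : Fin (N + 2) × Fin (N + 2)) (x : Fin N → ℂ) :
    edge c a x = edge c a 0 + edgeForm a x := by
  simp only [edge, edgeForm, sub_apply, conf_eq_add_pointForm c x]
  ring

lemma contDiff_edge (c : ℂ) (a : Fin (N + 2) × Fin (N + 2)) :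
    ContDiff ℝ 1 (edge (N := N) c a) :=
  (contDiff_conf c a.2).sub (contDiff_conf c a.1)

lemma edge_ne_zero {c : ℂ} {x : Fin N → ℂ} (hx : Function.Injective (conf c x))
    {a : Fin (N + 2) × Fin (N + 2)} (ha : a.1 ≠ a.2) : edge c a x ≠ 0 :=
  sub_ne_zero.2 fun h => ha (hx h).symm

lemma isOpen_injective_conf (c : ℂ) : IsOpen {x : Fin N → ℂ | Function.Injective (conf c x)} := by
  have : {x : Fin N → ℂ | Function.Injective (conf c x)} =
      ⋂ a : Fin (N + 2), ⋂ b : Fin (N + 2), ⋂ _ : a ≠ b, {x | conf c x a ≠ conf c x b} := by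
    ext x
    simp only [Set.mem_ofPred_eq, Set.mem_iInter, Function.Injective]
    exact forall₂_congr fun a b => not_imp_not.symm
  rw [this]
  exact isOpen_iInter_of_finite fun a => isOpen_iInter_of_finite fun b =>
    isOpen_iInter_of_finite fun _ => isOpen_ne_fun (continuous_conf c a) (continuous_conf c b)

end Configurations

section Cutoff

open Filter Topology

/-- The real part of the logarithmic derivative of the coordinate of the plane. -/
def reLogForm (z : ℂ) : ℂ →L[ℝ] ℝ :=
  Complex.reCLM ∘L (z⁻¹ • (1 : ℂ →L[ℂ] ℂ)).restrictScalars ℝ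

lemma hasFDerivAt_log_norm {z : ℂ} (hz : z ≠ 0) :
    HasFDerivAt (fun w : ℂ => Real.log ‖w‖) (reLogForm z) z := by
  have h1 : (fun w : ℂ => Real.log ‖w‖) = fun w => (1 / 2) * Real.log (w.re * w.re + w.im * w.im) := by
    funext w
    rw [← Complex.normSq_apply, Complex.normSq_eq_norm_sq, Real.log_pow]
    push_cast
    ring
  have hn : z.re * z.re + z.im * z.im ≠ 0 := by
    rw [← Complex.normSq_apply]
    exact (Complex.normSq_pos.2 hz).ne'
  have hre : HasFDerivAt (fun w : ℂ => w.re) Complex.reCLM z := Complex.reCLM.hasFDerivAt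
  have him : HasFDerivAt (fun w : ℂ => w.im) Complex.imCLM z := Complex.imCLM.hasFDerivAt
  rw [h1]
  refine ((((hre.mul hre).add (him.mul him)).log hn).const_mul (1 / 2)).congr_fderiv ?_
  ext v
  simp only [reLogForm, smul_apply, add_apply,
    ContinuousLinearMap.comp_apply, Complex.reCLM_apply, Complex.imCLM_apply, smul_eq_mul,
    ContinuousLinearMap.coe_restrictScalars', one_apply_eq_self, Complex.mul_re,
    Complex.inv_re, Complex.inv_im, Complex.normSq_apply, Pi.add_apply, Pi.mul_apply]
  field_simp
  ring

lemma exists_cutoff_identity : ∃ k : ℝ → ℝ, ContDiff ℝ 1 k ∧ (∀ t, 2 ≤ |t| → k t = 0) ∧ k 0 = 0 ∧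
    deriv k 0 = 1 ∧ ∃ C, ∀ t, |deriv k t| ≤ C := by
  let χ : ContDiffBump (0 : ℝ) := ⟨1, 2, by norm_num, by norm_num⟩
  have hk : ContDiff ℝ 1 fun t => t * χ t := contDiff_id.mul χ.contDiff
  have h2 : ∀ t : ℝ, 2 ≤ |t| → t * χ t = 0 := fun t ht => by
    rw [χ.zero_of_le_dist (by simpa using ht), mul_zero]
  refine ⟨fun t => t * χ t, hk, h2, by simp, ?_, ?_⟩
  · have h1 : (fun t => t * χ t) =ᶠ[𝓝 0] fun t => t := by
      filter_upwards [χ.eventuallyEq_one] with t ht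
      rw [ht, Pi.one_apply, mul_one]
    rw [h1.deriv_eq, deriv_id'']
  · have hcs : HasCompactSupport fun t => t * χ t := χ.hasCompactSupport.mul_left
    obtain ⟨C, hC⟩ := hcs.deriv.exists_bound_of_continuous (hk.continuous_deriv (by simp))
    exact ⟨C, hC⟩

/-- Compactly supported `C¹` approximations of `log ‖z‖`. -/
lemma exists_cutoff_log : ∃ (q s : ℕ → ℂ → ℝ) (C : ℝ), (∀ r, ContDiff ℝ 1 (q r)) ∧
    (∀ r, HasCompactSupport (q r)) ∧
    (∀ r z, z ≠ 0 → HasFDerivAt (q r) (s r z • reLogForm z) z) ∧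
    (∀ r, Measurable (s r)) ∧ (∀ r z, |s r z| ≤ C) ∧
    ∀ z, Tendsto (fun r => s r z) atTop (𝓝 1) := by
  obtain ⟨k, hk, hk2, hk0, hk1, C, hC⟩ := exists_cutoff_identity
  have hzero : ∀ (r : ℕ) (L : ℝ), 2 * ((r : ℝ) + 1) ≤ |L| → k (L / ((r : ℝ) + 1)) = 0 := by
    intro r L hL
    refine hk2 _ ?_
    have : (0 : ℝ) < (r : ℝ) + 1 := by positivity
    rwa [abs_div, abs_of_pos this, le_div_iff₀ this]
  refine ⟨fun r z => ((r : ℝ) + 1) * k (Real.log ‖z‖ / ((r : ℝ) + 1)),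
    fun r z => deriv k (Real.log ‖z‖ / ((r : ℝ) + 1)), C, ?_, ?_, ?_, ?_, fun r z => hC _, ?_⟩
  · intro r
    rw [contDiff_iff_contDiffAt]
    intro z
    rcases eq_or_ne z 0 with rfl | hz
    · have : (fun z : ℂ => ((r : ℝ) + 1) * k (Real.log ‖z‖ / ((r : ℝ) + 1))) =ᶠ[𝓝 0] fun _ => 0 := by
        filter_upwards [Metric.ball_mem_nhds (0 : ℂ) (Real.exp_pos (-(2 * ((r : ℝ) + 1))))] with z hz
        rcases eq_or_ne z 0 with rfl | hz0
        · simp [hk0]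
        · rw [mem_ball_zero_iff, ← Real.log_lt_iff_lt_exp (norm_pos_iff.2 hz0)] at hz
          rw [hzero r _ (le_abs.2 (Or.inr (by linarith))), mul_zero]
      exact contDiffAt_const.congr_of_eventuallyEq this
    · have h1 : ContDiffAt ℝ 1 (fun z : ℂ => Real.log ‖z‖) z :=
        (contDiffAt_norm ℝ hz).log (norm_ne_zero_iff.2 hz)
      exact contDiffAt_const.mul (hk.contDiffAt.comp z (h1.div_const _))
  · intro r
    refine HasCompactSupport.intro (isCompact_closedBall 0 (Real.exp (2 * ((r : ℝ) + 1)))) ?_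
    intro z hz
    rw [mem_closedBall_zero_iff, not_le] at hz
    rw [← Real.lt_log_iff_exp_lt ((Real.exp_pos _).trans hz)] at hz
    simp only [hzero r _ (le_abs.2 (Or.inl hz.le)), mul_zero]
  · intro r z hz
    have hr : (r : ℝ) + 1 ≠ 0 := by positivity
    have h1 : HasDerivAt k (deriv k (Real.log ‖z‖ / ((r : ℝ) + 1))) (Real.log ‖z‖ / ((r : ℝ) + 1)) :=
      (hk.differentiable (by simp) _).hasDerivAt
    have h2 := ((hasFDerivAt_log_norm hz).mul_const ((r : ℝ) + 1)⁻¹)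
    simp only [← div_eq_mul_inv] at h2
    refine ((h1.comp_hasFDerivAt z h2).const_mul ((r : ℝ) + 1)).congr_fderiv ?_
    ext v
    simp only [smul_apply, smul_eq_mul]
    field_simp
  · intro r
    exact (measurable_deriv k).comp ((Real.measurable_log.comp measurable_norm).div_const _)
  · intro z
    rw [← hk1]
    refine ((hk.continuous_deriv (by simp)).tendsto 0).comp ?_
    exact tendsto_const_nhds.div_atTop
      (tendsto_atTop_add_const_right _ _ tendsto_natCast_atTop_atTop)

end Cutoff

section NullSets

variable {N : ℕ}

lemma edgeForm_surjective_or_edge_const {a : Fin (N + 2) × Fin (N + 2)} (ha : a.1 ≠ a.2) :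
    (∃ v, edgeForm a v = Complex.I) ∨
      (∀ (c : ℂ) (x : Fin N → ℂ), edge c a x = c) ∨ ∀ (c : ℂ) (x : Fin N → ℂ), edge c a x = -c := by
  obtain ⟨i, j⟩ := a
  have hI : ∀ (k : Fin N) (w : ℂ) (l : Fin (N + 2)), k.succ.succ ≠ l →
      conf 0 (Pi.single k w) l = 0 := by
    intro k w
    simp +contextual [forall_fin_add_two, eq_comm]
  simp only [edgeForm, sub_apply, pointForm_apply, edge]
  revert i
  refine forall_fin_add_two.2 ⟨?_, ?_, fun k h => ?_⟩
  · revert j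
    refine forall_fin_add_two.2 ⟨by simp, by simp, fun k h => Or.inl ⟨Pi.single k Complex.I, ?_⟩⟩
    simp
  · revert j
    refine forall_fin_add_two.2 ⟨by simp, by simp, fun k h => Or.inl ⟨Pi.single k Complex.I, ?_⟩⟩
    simp
  · refine Or.inl ⟨Pi.single k (-Complex.I), ?_⟩
    simp [hI k _ j h]

variable (μ : Measure (Fin N → ℂ)) [μ.IsAddHaarMeasure]

lemma measure_setOf_linearForm_eq (L : (Fin N → ℂ) →ₗ[ℝ] ℝ) {v : Fin N → ℂ} (hv : L v = 1) (t : ℝ) :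
    μ {x | L x = t} = 0 := by
  have h1 : {x | L x = t} = (fun x => x + -(t • v)) ⁻¹' (LinearMap.ker L : Set (Fin N → ℂ)) := by
    ext x
    simp [hv, add_neg_eq_zero]
  rw [h1, measure_preimage_add_right]
  refine Measure.addHaar_submodule μ _ fun h => ?_
  rw [LinearMap.ker_eq_top] at h
  simp [h] at hv

lemma measure_edge_im_eq_zero_of_edgeForm {c : ℂ} {a : Fin (N + 2) × Fin (N + 2)} {v : Fin N → ℂ}
    (hv : edgeForm a v = Complex.I) : μ {x | (edge c a x).im = 0} = 0 := by
  have h1 := measure_setOf_linearForm_eq μ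
    (Complex.imLm ∘ₗ (edgeForm a).toLinearMap.restrictScalars ℝ) (v := v) (by simp [hv])
    (-(edge c a 0).im)
  convert h1 using 4 with x
  rw [edge_eq_add_edgeForm, Complex.add_im, eq_neg_iff_add_eq_zero, add_comm]
  rfl

lemma measure_edge_im_eq_zero {c : ℂ} (hc : c.im ≠ 0) {a : Fin (N + 2) × Fin (N + 2)}
    (ha : a.1 ≠ a.2) : μ {x | (edge c a x).im = 0} = 0 := by
  rcases edgeForm_surjective_or_edge_const ha with ⟨v, hv⟩ | h | h
  · exact measure_edge_im_eq_zero_of_edgeForm μ hv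
  · simp [h, hc]
  · simp [h, hc]

lemma measure_edge_eq_zero {c : ℂ} (hc : c ≠ 0) {a : Fin (N + 2) × Fin (N + 2)}
    (ha : a.1 ≠ a.2) : μ {x | edge c a x = 0} = 0 := by
  rcases edgeForm_surjective_or_edge_const ha with ⟨v, hv⟩ | h | h
  · exact measure_mono_null (fun x (hx : edge c a x = 0) => by simp [hx])
      (measure_edge_im_eq_zero_of_edgeForm (c := c) μ hv)
  · simp [h, hc]
  · simp [h, hc]

lemma ae_injective_conf {c : ℂ} (hc : c ≠ 0) : ∀ᵐ x ∂μ, Function.Injective (conf c x) := by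
  have h : ∀ᵐ x ∂μ, ∀ a b : Fin (N + 2), a ≠ b → edge c (a, b) x ≠ 0 := by
    simp only [ae_all_iff]
    exact fun a b hab => measure_eq_zero_iff_ae_notMem.1 (measure_edge_eq_zero μ hc hab)
  filter_upwards [h] with x hx a b hab
  by_contra hne
  exact hx a b hne (sub_eq_zero.2 hab.symm)

end NullSets

section GaugeFixed

open Filter Topology

variable {N : ℕ}

/-- The real part of the logarithmic derivative of a separation vector. -/
def reEdgeForm (c : ℂ) (a : Fin (N + 2) × Fin (N + 2)) (x : Fin N → ℂ) : (Fin N → ℂ) →ₗ[ℝ] ℝ :=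
  Complex.reLm ∘ₗ (logForm c a x).toLinearMap.restrictScalars ℝ

/-- The imaginary part of the logarithmic derivative of a separation vector, which is the
derivative of its angle. -/
def imEdgeForm (c : ℂ) (a : Fin (N + 2) × Fin (N + 2)) (x : Fin N → ℂ) : (Fin N → ℂ) →ₗ[ℝ] ℝ :=
  Complex.imLm ∘ₗ (logForm c a x).toLinearMap.restrictScalars ℝ

/-- If some edge-closed set of vertices contains the two fixed vertices but not all vertices, the
logarithmic forms are linearly dependent. -/
lemma formDet_reEdgeForm_eq_zero_of_disconnected {e : Fin (2 * N) → Fin (N + 2) × Fin (N + 2)}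
    {S : Set (Fin (N + 2))} (h0 : 0 ∈ S) (h1 : 1 ∈ S) (he : ∀ α, (e α).1 ∈ S ↔ (e α).2 ∈ S)
    {k₀ : Fin (N + 2)} (hk₀ : k₀ ∉ S) (c : ℂ) (x : Fin N → ℂ) :
    formDet (fun α => reEdgeForm c (e α) x) = 0 := by
  classical
  let v : Fin N → ℂ := fun k => if k.succ.succ ∈ S then 0 else 1
  have hv : ∀ k, conf 0 v k = if k ∈ S then 0 else 1 :=
    forall_fin_add_two.2 ⟨by simp [h0], by simp [h1], fun k => rfl⟩
  refine formDet_eq_zero_of_apply_eq_zero (v := v) (fun h => ?_) fun α => ?_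
  · have h2 := hv k₀
    rw [if_neg hk₀, h] at h2
    exact zero_ne_one ((pointForm k₀).map_zero.symm.trans h2)
  · have h3 : edgeForm (e α) v = 0 := by
      simp only [edgeForm, sub_apply, pointForm_apply, hv, he α, sub_self]
    simp [reEdgeForm, logForm, h3]

/-- Multiplying by a plateau function does not change the Jacobian of a tuple of functions of the
separation vectors whose supports have bounded intersection. -/
lemma exists_contDiff_det_fderiv_eq {e : Fin (2 * N) → Fin (N + 2) × Fin (N + 2)} {q : ℂ → ℝ}
    (hq : ContDiff ℝ 1 q) {c : ℂ}
    (hK : Bornology.IsBounded {x : Fin N → ℂ | ∀ α, edge c (e α) x ∈ tsupport q}) :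
    ∃ F : (Fin N → ℂ) → (Fin N → ℂ), ContDiff ℝ 1 F ∧ HasCompactSupport F ∧
      ∀ x, (fderiv ℝ F x).det =
        formDet fun α => (fderiv ℝ (fun y => q (edge c (e α) y)) x).toLinearMap := by
  obtain ⟨ρ, hρ0, hρ⟩ := hK.subset_closedBall_lt 0 (0 : Fin N → ℂ)
  let ψ : ContDiffBump (0 : Fin N → ℂ) := ⟨ρ + 1, ρ + 2, by linarith, by linarith⟩
  let H : (Fin N → ℂ) → Fin (2 * N) → ℝ := fun x α => ψ x * q (edge c (e α) x)
  have hqe : ∀ α, ContDiff ℝ 1 fun y => q (edge c (e α) y) := fun α => hq.comp (contDiff_edge c _)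
  have hHα : ∀ α, ContDiff ℝ 1 fun x => H x α := fun α => ψ.contDiff.mul (hqe α)
  let Φ := (planeCoords N).toContinuousLinearEquiv
  refine ⟨fun x => Φ (H x), Φ.contDiff.comp (contDiff_pi.2 hHα), ?_, fun x => ?_⟩
  · refine ψ.hasCompactSupport.mono fun x hx => ?_
    contrapose! hx
    have hψ : ψ x = 0 := by simpa using hx
    have : H x = 0 := by
      funext α
      simp [H, hψ]
    simp [this]
  have hd : HasFDerivAt (fun x => Φ (H x)) ((Φ : _ →L[ℝ] _) ∘L
      ContinuousLinearMap.pi fun α => fderiv ℝ (fun y => H y α) x) x :=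
    Φ.hasFDerivAt.comp x (hasFDerivAt_pi.2 fun α =>
      ((hHα α).differentiable (by simp) x).hasFDerivAt)
  have h1 : (fderiv ℝ (fun x => Φ (H x)) x).det =
      formDet fun α => (fderiv ℝ (fun y => H y α) x).toLinearMap := by
    rw [hd.fderiv, ContinuousLinearMap.det, det_eq_formDet]
    congr 1
    ext α v
    change (planeCoords N).symm (planeCoords N _) α = _
    rw [LinearEquiv.symm_apply_apply]
    rfl
  rw [h1]
  by_cases hx : ∀ α, edge c (e α) x ∈ tsupport q
  · congr 1
    funext α
    congr 1
    refine Filter.EventuallyEq.fderiv_eq ?_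
    have hxρ : x ∈ Metric.ball (0 : Fin N → ℂ) (ρ + 1) :=
      Metric.closedBall_subset_ball (by linarith) (hρ hx)
    filter_upwards [ψ.eventuallyEq_one_of_mem_ball hxρ] with y hy
    simp [H, hy]
  · push Not at hx
    obtain ⟨α, hα⟩ := hx
    have hz : (fun y => q (edge c (e α) y)) =ᶠ[𝓝 x] fun _ => 0 :=
      (contDiff_edge c (e α)).continuous.continuousAt.eventually
        (notMem_tsupport_iff_eventuallyEq.1 hα)
    have hz' : (fun y => H y α) =ᶠ[𝓝 x] fun _ => 0 := by
      filter_upwards [hz] with y hy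
      simp [H, hy]
    rw [formDet_eq_zero_of_eq_zero α, formDet_eq_zero_of_eq_zero α]
    · rw [hz.fderiv_eq]
      simp
    · rw [hz'.fderiv_eq]
      simp

variable (μ : Measure (Fin N → ℂ)) [μ.IsAddHaarMeasure]

lemma setIntegral_prod_mul_formDet_reEdgeForm (hN : 0 < N)
    {e : Fin (2 * N) → Fin (N + 2) × Fin (N + 2)} (he : ∀ α, (e α).1 ≠ (e α).2) {q s : ℂ → ℝ}
    (hq : ContDiff ℝ 1 q) (hc : HasCompactSupport q)
    (hqs : ∀ z, z ≠ 0 → HasFDerivAt q (s z • reLogForm z) z) :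
    ∫ x in {x | Function.Injective (conf 1 x)},
      (∏ α, s (edge 1 (e α) x)) * formDet (fun α => reEdgeForm 1 (e α) x) ∂μ = 0 := by
  let K : Set (Fin N → ℂ) := {x | ∀ α, edge 1 (e α) x ∈ tsupport q}
  let S : Set (Fin (N + 2)) := {k | ∃ C : ℝ, ∀ x ∈ K, ‖conf 1 x k‖ ≤ C}
  obtain ⟨M, hM⟩ := hc.isCompact.isBounded.exists_norm_le
  have hS : ∀ α, (e α).1 ∈ S ↔ (e α).2 ∈ S := by
    intro α
    constructor
    · rintro ⟨C, hC⟩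
      refine ⟨M + C, fun x hx => ?_⟩
      have h1 : conf 1 x (e α).2 = edge 1 (e α) x + conf 1 x (e α).1 := by simp [edge]
      rw [h1]
      exact (norm_add_le _ _).trans (add_le_add (hM _ (hx α)) (hC x hx))
    · rintro ⟨C, hC⟩
      refine ⟨C + M, fun x hx => ?_⟩
      have h1 : conf 1 x (e α).1 = conf 1 x (e α).2 - edge 1 (e α) x := by simp [edge]
      rw [h1]
      exact (norm_sub_le _ _).trans (add_le_add (hC x hx) (hM _ (hx α)))
  by_cases hall : ∀ k, k ∈ S
  · choose C hC using hall
    have hK : Bornology.IsBounded K := by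
      refine isBounded_iff_forall_norm_le.2 ⟨∑ k, |C k|, fun x hx => ?_⟩
      refine (pi_norm_le_iff_of_nonneg (Finset.sum_nonneg fun _ _ => abs_nonneg _)).2 fun k => ?_
      exact ((hC k.succ.succ x hx).trans (le_abs_self _)).trans
        (Finset.single_le_sum (f := fun k => |C k|) (fun _ _ => abs_nonneg _) (Finset.mem_univ _))
    obtain ⟨F, hF, hFc, hFd⟩ := exists_contDiff_det_fderiv_eq hq hK
    have : Nonempty (Fin N) := ⟨⟨0, hN⟩⟩
    rw [← integral_det_fderiv_eq_zero μ hF hFc,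
      setIntegral_congr_set (t := Set.univ)
        (eventuallyEq_univ.2 (ae_injective_conf μ one_ne_zero)), Measure.restrict_univ]
    refine integral_congr_ae ?_
    filter_upwards [ae_injective_conf μ one_ne_zero] with x hx
    rw [hFd, ← formDet_smul]
    congr 1
    funext α
    have hd := (hqs _ (edge_ne_zero hx (he α))).comp x
      ((hasFDerivAt_edge 1 (e α) x).restrictScalars ℝ)
    rw [show (fun y => q (edge 1 (e α) y)) = q ∘ edge 1 (e α) from rfl, hd.fderiv]
    ext v
    simp [reEdgeForm, reLogForm, logForm]
  · push Not at hall
    obtain ⟨k₀, hk₀⟩ := hall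
    have h := fun x => formDet_reEdgeForm_eq_zero_of_disconnected (S := S) ⟨0, by simp⟩
      ⟨1, by simp⟩ hS hk₀ 1 x
    simp [h]

/-- The vanishing lemma in the gauge in which two of the points are fixed. -/
theorem setIntegral_formDet_imEdgeForm (hN : 0 < N)
    {e : Fin (2 * N) → Fin (N + 2) × Fin (N + 2)} (he : ∀ α, (e α).1 ≠ (e α).2) :
    ∫ x in {x | Function.Injective (conf 1 x)}, formDet (fun α => imEdgeForm 1 (e α) x) ∂μ = 0 := by
  have him : ∀ x, formDet (fun α => imEdgeForm 1 (e α) x) =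
      formDet (fun α => reEdgeForm 1 (e α) x) * LinearMap.det
        (((-Complex.I) • (1 : (Fin N → ℂ) →ₗ[ℂ] (Fin N → ℂ))).restrictScalars ℝ) := fun x =>
    formDet_im fun α => (logForm 1 (e α) x).toLinearMap
  simp only [him]
  rw [integral_mul_const]
  suffices h : ∫ x in {x | Function.Injective (conf 1 x)},
      formDet (fun α => reEdgeForm 1 (e α) x) ∂μ = 0 by rw [h, zero_mul]
  by_cases h_int : IntegrableOn (fun x => formDet (fun α => reEdgeForm 1 (e α) x))
      {x | Function.Injective (conf 1 x)} μ
  swap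
  · exact integral_undef h_int
  obtain ⟨q, s, C, hq, hc, hqs, hsm, hsC, hs1⟩ := exists_cutoff_log
  have hlim := tendsto_integral_of_dominated_convergence
    (μ := μ.restrict {x | Function.Injective (conf 1 x)})
    (F := fun r x => (∏ α, s r (edge 1 (e α) x)) * formDet (fun α => reEdgeForm 1 (e α) x))
    (f := fun x => formDet (fun α => reEdgeForm 1 (e α) x))
    (fun x => (∏ _α : Fin (2 * N), C) * ‖formDet (fun α => reEdgeForm 1 (e α) x)‖)
    (fun r => (Measurable.aestronglyMeasurable (Finset.measurable_fun_prod _ fun α _ =>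
      (hsm r).comp (contDiff_edge 1 (e α)).continuous.measurable)).mul h_int.aestronglyMeasurable)
    (h_int.norm.const_mul _)
    (fun r => Eventually.of_forall fun x => by
      rw [norm_mul, norm_prod]
      gcongr
      exact hsC r _)
    (Eventually.of_forall fun x => by
      have h1 : Tendsto (fun r => ∏ α, s r (edge 1 (e α) x)) atTop (𝓝 (∏ _α : Fin (2 * N), 1)) :=
        tendsto_finsetProd _ fun α _ => hs1 _
      rw [Finset.prod_const_one] at h1
      simpa using h1.mul_const (formDet fun α => reEdgeForm 1 (e α) x))
  simp only [setIntegral_prod_mul_formDet_reEdgeForm μ hN he (hq _) (hc _) (hqs _)] at hlim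
  exact (tendsto_nhds_unique hlim tendsto_const_nhds)

end GaugeFixed

section Regauge

variable {N : ℕ}

/-- Relabel a configuration by `σ`, then move its first two points to `0` and `c'` by a
similarity. -/
def regauge (c c' : ℂ) (σ : Equiv.Perm (Fin (N + 2))) (x : Fin N → ℂ) : Fin N → ℂ := fun k =>
  c' * (edge c (σ 0, σ k.succ.succ) x * (edge c (σ 0, σ 1) x)⁻¹)

variable {c c' : ℂ} {σ : Equiv.Perm (Fin (N + 2))} {x : Fin N → ℂ}

lemma conf_regauge (hx : edge c (σ 0, σ 1) x ≠ 0) (k : Fin (N + 2)) :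
    conf c' (regauge c c' σ x) k = c' * (edge c (σ 0, σ k) x * (edge c (σ 0, σ 1) x)⁻¹) := by
  revert k
  refine forall_fin_add_two.2 ⟨?_, ?_, fun k => rfl⟩
  · simp [edge]
  · rw [mul_inv_cancel₀ hx, conf_one, mul_one]

lemma edge_regauge (hx : edge c (σ 0, σ 1) x ≠ 0) (a : Fin (N + 2) × Fin (N + 2)) :
    edge c' a (regauge c c' σ x) =
      c' * (edge c (σ a.1, σ a.2) x * (edge c (σ 0, σ 1) x)⁻¹) := by
  rw [edge, conf_regauge hx, conf_regauge hx]
  simp only [edge]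
  ring

lemma injective_conf_regauge (hc' : c' ≠ 0) (hx : Function.Injective (conf c x)) :
    Function.Injective (conf c' (regauge c c' σ x)) := by
  have h01 : edge c (σ 0, σ 1) x ≠ 0 := edge_ne_zero hx (by simp)
  intro a b hab
  rw [conf_regauge h01, conf_regauge h01] at hab
  have h := mul_right_cancel₀ (inv_ne_zero h01) (mul_left_cancel₀ hc' hab)
  exact σ.injective (hx (sub_left_injective h))

lemma regauge_regauge (hc' : c' ≠ 0) (hx : Function.Injective (conf c x)) :
    regauge c' c σ.symm (regauge c c' σ x) = x := by
  have h01 : edge c (σ 0, σ 1) x ≠ 0 := edge_ne_zero hx (by simp)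
  have hc : c ≠ 0 := fun h => zero_ne_one (hx (show conf c x 0 = conf c x 1 by simp [h]))
  funext k
  simp only [regauge.eq_1 c', edge_regauge h01, Equiv.apply_symm_apply]
  simp only [edge, conf_zero, conf_one, conf_succ_succ, sub_zero]
  simp only [edge] at h01
  field_simp

lemma differentiableAt_regauge (hx : edge c (σ 0, σ 1) x ≠ 0) :
    DifferentiableAt ℂ (regauge c c' σ) x :=
  differentiableAt_pi.2 fun _ => ((hasFDerivAt_edge c _ x).differentiableAt.mul
    ((hasFDerivAt_edge c _ x).differentiableAt.inv hx)).const_mul c'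

lemma logForm_comp_fderiv_regauge (hx : Function.Injective (conf c x))
    {a : Fin (N + 2) × Fin (N + 2)} (ha : a.1 ≠ a.2) (v : Fin N → ℂ) :
    logForm 1 (σ.symm a.1, σ.symm a.2) (regauge c 1 σ x) (fderiv ℂ (regauge c 1 σ) x v) =
      logForm c a x v - logForm c (σ 0, σ 1) x v := by
  have h01 : edge c (σ 0, σ 1) x ≠ 0 := edge_ne_zero hx (by simp)
  have ha0 : edge c a x ≠ 0 := edge_ne_zero hx ha
  have hev : (fun y => edge 1 (σ.symm a.1, σ.symm a.2) (regauge c 1 σ y) * edge c (σ 0, σ 1) y)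
      =ᶠ[nhds x] edge c a := by
    filter_upwards [(contDiff_edge c (σ 0, σ 1)).continuous.continuousAt.eventually_ne h01]
      with y hy
    rw [edge_regauge hy]
    simp [hy]
  have hd := ((hasFDerivAt_edge 1 (σ.symm a.1, σ.symm a.2) (regauge c 1 σ x)).comp x
    (differentiableAt_regauge (c' := 1) h01).hasFDerivAt).mul (hasFDerivAt_edge c (σ 0, σ 1) x)
  have h1 := DFunLike.congr_fun ((hd.congr_of_eventuallyEq hev.symm).unique
    (hasFDerivAt_edge c a x)) v
  simp only [Function.comp_apply, add_apply, smul_apply, ContinuousLinearMap.comp_apply,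
    smul_eq_mul, edge_regauge h01, Equiv.apply_symm_apply, Prod.mk.eta, one_mul] at h1
  simp only [logForm, smul_apply, smul_eq_mul, edge_regauge h01, Equiv.apply_symm_apply,
    Prod.mk.eta, one_mul]
  rw [← h1]
  field_simp
  ring

variable (μ : Measure (Fin N → ℂ)) [μ.IsAddHaarMeasure]

lemma exists_perm_apply_zero_one {i j : Fin (N + 2)} (h : i ≠ j) :
    ∃ σ : Equiv.Perm (Fin (N + 2)), σ 0 = i ∧ σ 1 = j := by
  refine ⟨Equiv.swap (Equiv.swap 0 i 1) j * Equiv.swap 0 i, ?_, ?_⟩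
  · rw [Equiv.Perm.mul_apply, Equiv.swap_apply_left, Equiv.swap_apply_of_ne_of_ne _ h]
    intro h1
    have h2 := (Equiv.swap_apply_left 0 i).trans h1
    exact zero_ne_one ((Equiv.swap 0 i).injective h2)
  · rw [Equiv.Perm.mul_apply, Equiv.swap_apply_left]

/-- The integral over the configurations with two fixed points of the product of angle forms
relative to the angle of a chosen edge vanishes. -/
theorem setIntegral_formDet_imEdgeForm_sub (hN : 0 < N) (hc : c ≠ 0)
    {e : Fin (2 * N + 1) → Fin (N + 2) × Fin (N + 2)} (he : ∀ α, (e α).1 ≠ (e α).2) :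
    ∫ x in {x | Function.Injective (conf c x)},
      formDet (fun α : Fin (2 * N) => imEdgeForm c (e α.succ) x - imEdgeForm c (e 0) x) ∂μ = 0 := by
  obtain ⟨σ, h0, h1⟩ := exists_perm_apply_zero_one (he 0)
  let e' : Fin (2 * N) → Fin (N + 2) × Fin (N + 2) := fun α =>
    (σ.symm (e α.succ).1, σ.symm (e α.succ).2)
  have himage : regauge c 1 σ '' {x | Function.Injective (conf c x)} =
      {x | Function.Injective (conf 1 x)} := by
    ext y
    constructor
    · rintro ⟨x, hx, rfl⟩
      exact injective_conf_regauge one_ne_zero hx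
    · intro hy
      exact ⟨regauge 1 c σ.symm y, injective_conf_regauge hc hy, regauge_regauge hc hy⟩
  have hcv := integral_image_eq_integral_abs_det_fderiv_smul μ
    (isOpen_injective_conf c).measurableSet
    (f := regauge c 1 σ) (f' := fun x => (fderiv ℂ (regauge c 1 σ) x).restrictScalars ℝ)
    (fun x hx => ((differentiableAt_regauge
      (edge_ne_zero hx (by simp))).hasFDerivAt.restrictScalars ℝ).hasFDerivWithinAt)
    (fun x hx y hy hxy => by
      rw [← regauge_regauge (c' := 1) (σ := σ) one_ne_zero hx, hxy,
        regauge_regauge one_ne_zero hy])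
    (fun y => formDet (fun α => imEdgeForm 1 (e' α) y))
  rw [himage, setIntegral_formDet_imEdgeForm μ hN
    (fun α => fun h => he α.succ (σ.symm.injective h))] at hcv
  rw [hcv]
  refine setIntegral_congr_fun (isOpen_injective_conf c).measurableSet fun x hx => ?_
  have hnn := det_restrictScalars_nonneg (fderiv ℂ (regauge c 1 σ) x).toLinearMap
  have hdet : ((fderiv ℂ (regauge c 1 σ) x).restrictScalars ℝ).det =
      LinearMap.det ((fderiv ℂ (regauge c 1 σ) x).toLinearMap.restrictScalars ℝ) := rfl
  simp only [hdet]
  rw [abs_of_nonneg hnn, smul_eq_mul, mul_comm (LinearMap.det _), ← formDet_comp]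
  congr 1
  funext α
  refine LinearMap.ext fun v => ?_
  have h := logForm_comp_fderiv_regauge (σ := σ) hx (he α.succ) v
  rw [h0, h1] at h
  exact ((congrArg Complex.im h).trans (Complex.sub_im _ _)).symm

end Regauge

section AngleForms

variable {N : ℕ}

/-- If a square matrix maps a vector with first entry `1` to the vector of ones, its determinant is
that of the differences of the rows with the first row, outside the first column. -/
lemma det_eq_det_sub_of_mulVec_eq_one {m : ℕ} {M : Matrix (Fin (m + 1)) (Fin (m + 1)) ℝ}
    {v : Fin (m + 1) → ℝ} (hv : v 0 = 1) (hM : M.mulVec v = 1) :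
    M.det = Matrix.det (Matrix.of fun α β : Fin m => M α.succ β.succ - M 0 β.succ) := by
  have h1 : (M.updateCol 0 1).det = M.det := by
    rw [← Matrix.cramer_apply, ← hM, Matrix.cramer_eq_adjugate_mulVec, Matrix.mulVec_mulVec,
      Matrix.adjugate_mul, Matrix.smul_mulVec, Matrix.one_mulVec, Pi.smul_apply, hv, smul_eq_mul,
      mul_one]
  rw [← h1]
  let B : Matrix (Fin (m + 1)) (Fin (m + 1)) ℝ := Matrix.of fun α β =>
    Fin.cases (M.updateCol 0 1 0 β) (fun α => M.updateCol 0 1 α.succ β - M.updateCol 0 1 0 β) α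
  have h2 : (M.updateCol 0 1).det = B.det := by
    refine Matrix.det_eq_of_forall_row_eq_smul_add_const (Fin.cases 0 fun _ => 1) 0 rfl ?_
    refine fun α β => Fin.cases ?_ (fun α => ?_) α
    · simp [B]
    · simp [B]
  rw [h2, Matrix.det_succ_column_zero, Fin.sum_univ_succ]
  simp [B, Matrix.updateCol_apply, Matrix.submatrix, Fin.succ_ne_zero]

lemma confPt_eq_conf (u : Fin (2 * N + 1) → ℝ) (k : Fin (N + 2)) :
    confPt (N + 2) u k = conf (Complex.exp (Complex.I * u 0)) (planeCoords N (Fin.tail u)) k := by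
  revert k
  refine forall_fin_add_two.2 ⟨rfl, ?_, fun k => ?_⟩
  · simp [confPt, padR]
    rfl
  · have h3 : 2 * (k.1 + 1 + 1) - 3 = 2 * k.1 + 1 := by omega
    have h2 : 2 * (k.1 + 1 + 1) - 2 = 2 * k.1 + 2 := by omega
    have hk := k.2
    have h4 : 2 * k.1 + 1 < 2 * (N + 2) - 3 := by omega
    have h5 : 2 * k.1 + 2 < 2 * (N + 2) - 3 := by omega
    simp only [confPt, Fin.val_succ, h2, h3, padR, dif_pos h4, dif_pos h5, conf_succ_succ]
    apply Complex.ext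
    · simp
      rfl
    · simp
      rfl

lemma conf_eq_mul_add_pointForm (c : ℂ) (x : Fin N → ℂ) (k : Fin (N + 2)) :
    conf c x k = c * conf 1 0 k + pointForm k x := by
  rw [conf_eq_add_pointForm, ← conf_smul, mul_one, smul_zero]

lemma exists_hasFDerivAt_confPt (u : Fin (2 * N + 1) → ℝ) (k : Fin (N + 2)) :
    ∃ L : (Fin (2 * N + 1) → ℝ) →L[ℝ] ℂ,
      HasFDerivAt (fun v : Fin (2 * N + 1) → ℝ => confPt (N + 2) v k) L u ∧
      ∀ w, L w = conf (Complex.exp (Complex.I * u 0) * (Complex.I * w 0))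
        (planeCoords N (Fin.tail w)) k := by
  let T : (Fin (2 * N + 1) → ℝ) →L[ℝ] (Fin N → ℂ) := LinearMap.toContinuousLinearMap
    ((planeCoords N).toLinearMap ∘ₗ LinearMap.funLeft ℝ ℝ Fin.succ)
  let P : (Fin (2 * N + 1) → ℝ) →L[ℝ] ℂ :=
    Complex.I • (Complex.ofRealCLM ∘L ContinuousLinearMap.proj 0)
  have h1 : (fun v : Fin (2 * N + 1) → ℝ => confPt (N + 2) v k) = fun v =>
      Complex.exp (P v) * conf 1 0 k + (pointForm k).restrictScalars ℝ (T v) := by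
    funext v
    rw [confPt_eq_conf, conf_eq_mul_add_pointForm]
    rfl
  rw [h1]
  refine ⟨_, (P.hasFDerivAt.cexp.mul_const (conf 1 0 k)).add
    (((pointForm k).restrictScalars ℝ).hasFDerivAt.comp u T.hasFDerivAt), fun w => ?_⟩
  rw [conf_eq_mul_add_pointForm (Complex.exp (Complex.I * u 0) * (Complex.I * w 0))]
  change conf 1 0 k * (Complex.exp (P u) * P w) + pointForm k (T w) = _
  rw [mul_comm (conf 1 0 k)]
  rfl

lemma fderiv_arg_confPt_sub {u : Fin (2 * N + 1) → ℝ} {a : Fin (N + 2) × Fin (N + 2)}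
    (h : confPt (N + 2) u a.2 - confPt (N + 2) u a.1 ∈ Complex.slitPlane)
    (w : Fin (2 * N + 1) → ℝ) :
    fderiv ℝ (fun v : Fin (2 * N + 1) → ℝ =>
        Complex.arg (confPt (N + 2) v a.2 - confPt (N + 2) v a.1)) u w =
      ((edge (Complex.exp (Complex.I * u 0)) a (planeCoords N (Fin.tail u)))⁻¹ *
        edge (Complex.exp (Complex.I * u 0) * (Complex.I * w 0)) a
          (planeCoords N (Fin.tail w))).im := by
  obtain ⟨L₁, hL₁, hw₁⟩ := exists_hasFDerivAt_confPt u a.1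
  obtain ⟨L₂, hL₂, hw₂⟩ := exists_hasFDerivAt_confPt u a.2
  have hlog := ((Complex.hasStrictDerivAt_log h).hasDerivAt.hasFDerivAt.restrictScalars ℝ).comp u
    (hL₂.fun_sub hL₁)
  have him := Complex.imCLM.hasFDerivAt.comp u hlog
  have hfun : (fun v : Fin (2 * N + 1) → ℝ =>
      Complex.arg (confPt (N + 2) v a.2 - confPt (N + 2) v a.1)) = Complex.imCLM ∘ Complex.log ∘
        fun v : Fin (2 * N + 1) → ℝ => confPt (N + 2) v a.2 - confPt (N + 2) v a.1 := by
    funext v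
    simp [Complex.log_im]
  rw [hfun, him.fderiv]
  simp only [edge, ← confPt_eq_conf, ← hw₁, ← hw₂]
  exact congrArg Complex.im (mul_comm _ _)

/-- The determinant of the angle forms is that of the angle forms relative to the first one, in the
coordinates of the free points. -/
lemma det_fderiv_arg_confPt {e : Fin (2 * N + 1) → Fin (N + 2) × Fin (N + 2)}
    {u : Fin (2 * N + 1) → ℝ}
    (h : ∀ α, confPt (N + 2) u (e α).2 - confPt (N + 2) u (e α).1 ∈ Complex.slitPlane) :
    Matrix.det (Matrix.of fun α β : Fin (2 * N + 1) => (1 / (2 * Real.pi)) *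
      fderiv ℝ (fun v : Fin (2 * N + 1) → ℝ =>
        Complex.arg (confPt (N + 2) v (e α).2 - confPt (N + 2) v (e α).1)) u (Pi.single β 1)) =
    (1 / (2 * Real.pi)) ^ (2 * N + 1) * formDet (fun α : Fin (2 * N) =>
      imEdgeForm (Complex.exp (Complex.I * u 0)) (e α.succ) (planeCoords N (Fin.tail u)) -
        imEdgeForm (Complex.exp (Complex.I * u 0)) (e 0) (planeCoords N (Fin.tail u))) := by
  set c := Complex.exp (Complex.I * u 0) with hc
  set x := planeCoords N (Fin.tail u) with hx
  let A : Fin (2 * N + 1) → (Fin (2 * N + 1) → ℝ) →L[ℝ] ℝ := fun α =>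
    fderiv ℝ (fun v : Fin (2 * N + 1) → ℝ =>
      Complex.arg (confPt (N + 2) v (e α).2 - confPt (N + 2) v (e α).1)) u
  have hA : ∀ α w, A α w = ((edge c (e α) x)⁻¹ *
      edge (c * (Complex.I * w 0)) (e α) (planeCoords N (Fin.tail w))).im := fun α w =>
    fderiv_arg_confPt_sub (h α) w
  let M : Matrix (Fin (2 * N + 1)) (Fin (2 * N + 1)) ℝ := Matrix.of fun α β => A α (Pi.single β 1)
  change Matrix.det ((1 / (2 * Real.pi)) • M) = _
  rw [Matrix.det_smul, Fintype.card_fin]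
  congr 1
  let v : Fin (2 * N + 1) → ℝ := Fin.cons 1 ((planeCoords N).symm (Complex.I • x))
  have hv : ∀ α, A α v = 1 := by
    intro α
    have hne : edge c (e α) x ≠ 0 := by
      have := Complex.slitPlane_ne_zero (h α)
      rwa [confPt_eq_conf, confPt_eq_conf] at this
    have h1 : edge (c * (Complex.I * v 0)) (e α) (planeCoords N (Fin.tail v)) =
        Complex.I * edge c (e α) x := by
      simp only [edge, v, Fin.tail_cons, LinearEquiv.apply_symm_apply, Fin.cons_zero,
        Complex.ofReal_one, mul_one, mul_comm c, conf_smul, mul_sub]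
    rw [hA, h1, mul_left_comm, inv_mul_cancel₀ hne, mul_one, Complex.I_im]
  have hM : M.mulVec v = 1 := by
    funext α
    rw [Pi.one_apply, ← hv α]
    conv_rhs => rw [pi_eq_sum_univ' v, map_sum]
    simp [Matrix.mulVec, dotProduct, M, mul_comm]
  rw [det_eq_det_sub_of_mulVec_eq_one (v := v) rfl hM, formDet]
  congr 1
  ext α β
  have hs : ∀ γ, M γ β.succ = imEdgeForm c (e γ) x (planeCoords N (Pi.single β 1)) := by
    intro γ
    have ht : Fin.tail (Pi.single β.succ (1 : ℝ) : Fin (2 * N + 1) → ℝ) = Pi.single β 1 := by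
      funext i
      simp [Fin.tail, Pi.single_apply]
    have h0 : (Pi.single β.succ (1 : ℝ) : Fin (2 * N + 1) → ℝ) 0 = 0 := by simp
    simp only [M, Matrix.of_apply, hA, ht, h0, Complex.ofReal_zero, mul_zero]
    rfl
  simp only [Matrix.of_apply, hs, LinearMap.sub_apply]

end AngleForms

section Fubini

variable {N : ℕ}

lemma measurableSet_injective_confPt :
    MeasurableSet {u : Fin (2 * N + 1) → ℝ | Function.Injective (confPt (N + 2) u)} := by
  have hcont : ∀ k, Continuous fun u : Fin (2 * N + 1) → ℝ => confPt (N + 2) u k := fun k =>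
    continuous_iff_continuousAt.2 fun u =>
      (exists_hasFDerivAt_confPt u k).choose_spec.1.continuousAt
  have h : {u : Fin (2 * N + 1) → ℝ | Function.Injective (confPt (N + 2) u)} =
      ⋂ (i : Fin (N + 2)) (j : Fin (N + 2)) (_ : i ≠ j),
        {u : Fin (2 * N + 1) → ℝ | confPt (N + 2) u i ≠ confPt (N + 2) u j} := by
    ext u
    simp only [Set.mem_ofPred_eq, Set.mem_iInter]
    exact ⟨fun hu i j hij hne => hij (hu hne), fun hu i j hij => by_contra fun h => hu i j h hij⟩
  rw [h]
  exact MeasurableSet.iInter fun i => MeasurableSet.iInter fun j => MeasurableSet.iInter fun _ =>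
    (isOpen_ne_fun (hcont i) (hcont j)).measurableSet

lemma ae_sin_ne_zero : ∀ᵐ θ : ℝ, Real.sin θ ≠ 0 := by
  have h : {θ : ℝ | Real.sin θ = 0} = Set.range fun n : ℤ => (n : ℝ) * Real.pi := by
    ext θ
    exact Real.sin_eq_zero_iff
  have h0 : volume {θ : ℝ | Real.sin θ = 0} = 0 := by
    rw [h]
    exact (Set.countable_range _).measure_zero _
  simpa [ae_iff] using h0

/-- The integral of the product of angle forms over the configurations whose second point has a
prescribed argument vanishes. -/
lemma setIntegral_det_fderiv_arg_confPt_cons (hN : 0 < N)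
    {e : Fin (2 * N + 1) → Fin (N + 2) × Fin (N + 2)} (he : ∀ α, (e α).1 ≠ (e α).2)
    {θ : ℝ} (hθ : Real.sin θ ≠ 0) :
    ∫ y in {y : Fin (2 * N) → ℝ |
        Function.Injective (confPt (N + 2) (Fin.cons θ y : Fin (2 * N + 1) → ℝ))},
      Matrix.det (Matrix.of fun α β : Fin (2 * N + 1) => (1 / (2 * Real.pi)) *
        fderiv ℝ (fun v : Fin (2 * N + 1) → ℝ =>
          Complex.arg (confPt (N + 2) v (e α).2 - confPt (N + 2) v (e α).1))
          (Fin.cons θ y : Fin (2 * N + 1) → ℝ) (Pi.single β 1)) = 0 := by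
  let Φ : (Fin (2 * N) → ℝ) ≃L[ℝ] (Fin N → ℂ) := (planeCoords N).toContinuousLinearEquiv
  let μ : Measure (Fin N → ℂ) := Measure.map Φ volume
  have hΦ : MeasurePreserving Φ volume μ := ⟨Φ.continuous.measurable, rfl⟩
  have : μ.IsAddHaarMeasure := Φ.isAddHaarMeasure_map volume
  set c := Complex.exp (Complex.I * θ) with hc
  have hcim : c.im ≠ 0 := by
    rwa [hc, mul_comm, Complex.exp_ofReal_mul_I_im]
  have hconf : ∀ y k, confPt (N + 2) (Fin.cons θ y : Fin (2 * N + 1) → ℝ) k = conf c (Φ y) k :=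
    fun y k => confPt_eq_conf _ k
  have hset : {y : Fin (2 * N) → ℝ |
      Function.Injective (confPt (N + 2) (Fin.cons θ y : Fin (2 * N + 1) → ℝ))} =
      Φ ⁻¹' {x | Function.Injective (conf c x)} := by
    ext y
    exact iff_of_eq (congrArg Function.Injective (funext (hconf y)))
  have hae : ∀ᵐ y : Fin (2 * N) → ℝ, ∀ α, (edge c (e α) (Φ y)).im ≠ 0 := by
    refine hΦ.quasiMeasurePreserving.ae (p := fun x => ∀ α, (edge c (e α) x).im ≠ 0) ?_
    refine ae_all_iff.2 fun α => ?_
    simpa [ae_iff] using measure_edge_im_eq_zero μ hcim (he α)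
  have h_int : (∫ y in Φ ⁻¹' {x | Function.Injective (conf c x)},
      (1 / (2 * Real.pi)) ^ (2 * N + 1) * formDet (fun α : Fin (2 * N) =>
        imEdgeForm c (e α.succ) (Φ y) - imEdgeForm c (e 0) (Φ y))) = 0 := by
    rw [integral_const_mul, hΦ.setIntegral_preimage_emb Φ.toHomeomorph.measurableEmbedding
      (fun x => formDet (fun α : Fin (2 * N) => imEdgeForm c (e α.succ) x - imEdgeForm c (e 0) x)),
      setIntegral_formDet_imEdgeForm_sub μ hN (fun h => hcim (by rw [h, Complex.zero_im])) he,
      mul_zero]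
  rw [hset, ← h_int]
  refine integral_congr_ae (ae_restrict_of_ae ?_)
  filter_upwards [hae] with y hy
  refine det_fderiv_arg_confPt fun α => ?_
  rw [hconf, hconf]
  exact Complex.mem_slitPlane_iff.2 (Or.inr (hy α))

theorem setIntegral_det_fderiv_arg_confPt (hN : 0 < N)
    {e : Fin (2 * N + 1) → Fin (N + 2) × Fin (N + 2)} (he : ∀ α, (e α).1 ≠ (e α).2)
    {I : Set ℝ} (hI : MeasurableSet I) :
    ∫ u in {u : Fin (2 * N + 1) → ℝ | u 0 ∈ I ∧ Function.Injective (confPt (N + 2) u)},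
      Matrix.det (Matrix.of fun α β : Fin (2 * N + 1) => (1 / (2 * Real.pi)) *
        fderiv ℝ (fun v : Fin (2 * N + 1) → ℝ =>
          Complex.arg (confPt (N + 2) v (e α).2 - confPt (N + 2) v (e α).1)) u
          (Pi.single β 1)) = 0 := by
  let g : (Fin (2 * N + 1) → ℝ) → ℝ := fun u =>
    Matrix.det (Matrix.of fun α β : Fin (2 * N + 1) => (1 / (2 * Real.pi)) *
      fderiv ℝ (fun v : Fin (2 * N + 1) → ℝ =>
        Complex.arg (confPt (N + 2) v (e α).2 - confPt (N + 2) v (e α).1)) u (Pi.single β 1))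
  let S : Set (Fin (2 * N + 1) → ℝ) :=
    {u | u 0 ∈ I ∧ Function.Injective (confPt (N + 2) u)}
  have hS : MeasurableSet S := (measurable_pi_apply 0 hI).inter measurableSet_injective_confPt
  change ∫ u in S, g u = 0
  rw [← integral_indicator hS,
    ← (volume_preserving_piFinSuccAbove (fun _ : Fin (2 * N + 1) => ℝ) 0).symm.integral_comp']
  by_cases h_int : Integrable (fun p : ℝ × (Fin (2 * N) → ℝ) =>
      S.indicator g ((MeasurableEquiv.piFinSuccAbove (fun _ : Fin (2 * N + 1) => ℝ) 0).symm p))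
  swap
  · exact integral_undef h_int
  refine (integral_prod _ h_int).trans (integral_eq_zero_of_ae ?_)
  filter_upwards [ae_sin_ne_zero] with θ hθ
  have hcons : ∀ y : Fin (2 * N) → ℝ,
      (MeasurableEquiv.piFinSuccAbove (fun _ : Fin (2 * N + 1) => ℝ) 0).symm (θ, y) =
        (Fin.cons θ y : Fin (2 * N + 1) → ℝ) := fun y => by
    simp [MeasurableEquiv.piFinSuccAbove]
    rfl
  have hmeas : Measurable fun y : Fin (2 * N) → ℝ => (Fin.cons θ y : Fin (2 * N + 1) → ℝ) :=
    measurable_pi_iff.2 (Fin.cases measurable_const measurable_pi_apply)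
  simp only [hcons, Pi.zero_apply]
  by_cases hθI : θ ∈ I
  · refine Eq.trans ?_ (setIntegral_det_fderiv_arg_confPt_cons hN he hθ)
    refine Eq.trans ?_ (integral_indicator (hmeas measurableSet_injective_confPt))
    refine integral_congr_ae (Filter.Eventually.of_forall fun y => ?_)
    by_cases hy : Function.Injective (confPt (N + 2) (Fin.cons θ y : Fin (2 * N + 1) → ℝ))
    · exact (Set.indicator_of_mem (s := S) ⟨hθI, hy⟩ g).trans
        (Set.indicator_of_mem hy fun y => g (Fin.cons θ y : Fin (2 * N + 1) → ℝ)).symm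
    · exact (Set.indicator_of_notMem (s := S) (fun h => hy h.2) g).trans
        (Set.indicator_of_notMem hy _).symm
  · rw [integral_eq_zero_of_ae]
    refine Filter.Eventually.of_forall fun y => Set.indicator_of_notMem (fun h => hθI ?_) _
    exact h.1

end Fubini

/-- Kontsevich's vanishing lemma: for `n ≥ 3` the integral over `C_n` of any wedge product
of `2n - 3` angle one-forms `ω_{iα jα} = (1/2π) d arg(p_{jα} - p_{iα})` vanishes. -/
theorem kontsevich_vanishing_lemma
    (n : ℕ) (hn : 3 ≤ n)
    (e : Fin (2 * n - 3) → Fin n × Fin n)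
    (he : ∀ α, (e α).1 ≠ (e α).2) :
    ∫ u in {u : Fin (2 * n - 3) → ℝ |
        u ⟨0, by omega⟩ ∈ Set.Ico (0 : ℝ) (2 * Real.pi) ∧
        Function.Injective (confPt n u)},
      Matrix.det (Matrix.of fun α β : Fin (2 * n - 3) =>
        (1 / (2 * Real.pi)) *
          fderiv ℝ (fun v => Complex.arg (confPt n v (e α).2 - confPt n v (e α).1)) u
            (Pi.single β 1)) = 0 := by
  obtain ⟨N, rfl⟩ : ∃ N, n = N + 2 := ⟨n - 2, by omega⟩
  exact setIntegral_det_fderiv_arg_confPt (N := N) (by omega) he measurableSet_Ico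
end
end

section
/- For z₀ fixed in the upper half-plane H, the integral ∫_{H ∖ {z₀}} ω(z₀, z) ∧ ω(z, z₀) vanishes, where ω(p,q) = dφ(p,q) and φ(p,q) = (1/2π) arg((q−p)/(q−p̄)) is Kontsevich's hyperbolic angle function. More generally, if z₁ ∈ H and z₂ ∈ H ∪ R with z₁ ≠ z₂, then ∫_{H ∖ {z₁,z₂}} ω(z₁,z) ∧ ω(z,z₂) = 0, integrating over z. -/
open MeasureTheory

/-- Kontsevich's (normalized) hyperbolic angle function
`φ(p,q) = (1/2π) arg((q-p)/(q-conj p))`. -/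
noncomputable def kontAngle (p q : ℂ) : ℝ :=
  (1 / (2 * Real.pi)) * Complex.arg ((q - p) / (q - (starRingEnd ℂ) p))

/-- The coefficient of the 2-form `ω(z₁,·) ∧ ω(·,z₂)` at `z`, where `ω = dφ`:
`∂ₓf ∂ᵧg - ∂ᵧf ∂ₓg` for `f = φ(z₁,·)` and `g = φ(·,z₂)`. -/
noncomputable def wedgeDensity (z₁ z₂ z : ℂ) : ℝ :=
  (fderiv ℝ (fun w => kontAngle z₁ w) z) 1 *
      (fderiv ℝ (fun w => kontAngle w z₂) z) Complex.I -
    (fderiv ℝ (fun w => kontAngle z₁ w) z) Complex.I *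
      (fderiv ℝ (fun w => kontAngle w z₂) z) 1

open ComplexConjugate

/-- The logarithmic derivative of `z ↦ (z - p) / (z - conj p)`. -/
noncomputable def blaschkeLogDeriv (p z : ℂ) : ℂ :=
  1 / (z - p) - 1 / (z - conj p)

theorem Complex.ae_re_ne (c : ℝ) : ∀ᵐ z : ℂ, z.re ≠ c := by
  have h : ∀ᵐ p : ℝ × ℝ, p.1 ≠ c :=
    Measure.quasiMeasurePreserving_fst.ae (Measure.ae_ne volume c)
  exact Complex.volume_preserving_equiv_real_prod.quasiMeasurePreserving.ae h

theorem Complex.ae_im_ne (c : ℝ) : ∀ᵐ z : ℂ, z.im ≠ c := by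
  have h : ∀ᵐ p : ℝ × ℝ, p.2 ≠ c :=
    Measure.quasiMeasurePreserving_snd.ae (Measure.ae_ne volume c)
  exact Complex.volume_preserving_equiv_real_prod.quasiMeasurePreserving.ae h

/-- The reflection of the plane in a line through `c`. -/
noncomputable def planeReflection (c e z : ℂ) : ℂ := c + e * conj (z - c)

theorem planeReflection_measurePreserving (c : ℂ) {e : ℂ} (he : ‖e‖ = 1) :
    MeasurePreserving (planeReflection c e) := by
  have h1 : MeasurePreserving (fun z : ℂ => z - c) := measurePreserving_sub_right volume c
  have h2 : MeasurePreserving (fun z : ℂ => conj z) := Complex.conjLIE.measurePreserving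
  have h3 : MeasurePreserving (fun z : ℂ => e * z) :=
    (rotation (⟨e, mem_sphere_zero_iff_norm.2 he⟩ : Circle)).measurePreserving
  have h4 : MeasurePreserving (fun z : ℂ => c + z) := measurePreserving_add_left volume c
  exact h4.comp (h3.comp (h2.comp h1))

theorem planeReflection_measurableEmbedding (c : ℂ) {e : ℂ} (he : ‖e‖ = 1) :
    MeasurableEmbedding (planeReflection c e) := by
  have he0 : e ≠ 0 := by rintro rfl; simp at he
  refine Continuous.measurableEmbedding (by unfold planeReflection; fun_prop) fun z w h => ?_
  have h' : conj z = conj w := by simpa [planeReflection, he0] using h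
  exact star_injective h'

theorem setIntegral_planeReflection (c : ℂ) {e : ℂ} (he : ‖e‖ = 1) (f : ℂ → ℝ) (s : Set ℂ) :
    ∫ z in planeReflection c e ⁻¹' s, f (planeReflection c e z) = ∫ z in s, f z :=
  (planeReflection_measurePreserving c he).setIntegral_preimage_emb
    (planeReflection_measurableEmbedding c he) f s

theorem setIntegral_eq_zero_of_planeReflection_odd (c : ℂ) {e : ℂ} (he : ‖e‖ = 1) {f : ℂ → ℝ}
    {s : Set ℂ} (hs : planeReflection c e ⁻¹' s = s)
    (hf : ∀ z, f (planeReflection c e z) = -f z) : ∫ z in s, f z = 0 := by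
  have h := setIntegral_planeReflection c he f s
  simp only [hs, hf, integral_neg] at h
  linarith

theorem fderiv_arg_comp {Q : ℂ → ℂ} {Q' z : ℂ} (hQ : HasDerivAt Q Q' z)
    (hz : Q z ∈ Complex.slitPlane) (a : ℝ) (v : ℂ) :
    fderiv ℝ (fun w => a * Complex.arg (Q w)) z v = a * (Q' / Q z * v).im := by
  have h := (Complex.imCLM.hasFDerivAt.comp z
    ((hQ.clog hz).hasFDerivAt.restrictScalars ℝ)).const_mul a
  have h' : (fun w => a * Complex.arg (Q w)) =
      fun w => a * (Complex.imCLM ∘ fun t => Complex.log (Q t)) w := by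
    funext w; simp [Complex.log_im]
  rw [h', h.fderiv]
  simp [mul_comm]

theorem kontAngle_eq_arg_mul (z p : ℂ) :
    kontAngle z p = (1 / (2 * Real.pi)) * Complex.arg ((z - p) * (z - conj p)) := by
  unfold kontAngle
  congr 1
  rcases eq_or_ne (z - conj p) 0 with h | h
  · have h' : p - conj z = 0 := by
      have := congrArg conj h
      simp only [map_sub, Complex.conj_conj, map_zero] at this
      linear_combination -this
    simp [h, h']
  · have hpos : 0 < (Complex.normSq (z - conj p))⁻¹ := inv_pos.2 (Complex.normSq_pos.2 h)
    rw [← Complex.arg_mul_real hpos ((z - p) * (z - conj p))]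
    congr 1
    have hc : conj (z - conj p) ≠ 0 := (map_ne_zero _).2 h
    have h' : p - conj z = -conj (z - conj p) := by simp
    rw [h', Complex.ofReal_inv, ← Complex.mul_conj]
    field_simp
    ring

theorem wedgeDensity_eq {z₁ z₂ z : ℂ} (h₁ : 0 < z₁.im) (hz : 0 < z.im)
    (hre₁ : z.re ≠ z₁.re) (hre₂ : z.re ≠ z₂.re) :
    wedgeDensity z₁ z₂ z = (1 / (2 * Real.pi)) ^ 2 *
      ((blaschkeLogDeriv z₁ z / conj (z - z₂)).im +
        (blaschkeLogDeriv z₁ z / conj (z - conj z₂)).im) := by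
  have ha : z - z₁ ≠ 0 := fun h => hre₁ (by simpa [sub_eq_zero] using congrArg Complex.re h)
  have hb : z - conj z₁ ≠ 0 := fun h => hre₁ (by simpa [sub_eq_zero] using congrArg Complex.re h)
  have hc : z - z₂ ≠ 0 := fun h => hre₂ (by simpa [sub_eq_zero] using congrArg Complex.re h)
  have hd : z - conj z₂ ≠ 0 := fun h => hre₂ (by simpa [sub_eq_zero] using congrArg Complex.re h)
  have hs₁ : (z - z₁) / (z - conj z₁) ∈ Complex.slitPlane := by
    refine Complex.mem_slitPlane_iff.2 (Or.inr ?_)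
    have hn : Complex.normSq (z - conj z₁) ≠ 0 := (Complex.normSq_pos.2 hb).ne'
    have : ((z - z₁) / (z - conj z₁)).im
        = -(2 * z₁.im * (z.re - z₁.re)) / Complex.normSq (z - conj z₁) := by
      rw [Complex.div_im]
      simp only [Complex.sub_im, Complex.sub_re, Complex.conj_re, Complex.conj_im]
      ring
    rw [this]
    exact div_ne_zero
      (neg_ne_zero.2 (mul_ne_zero (by positivity) (sub_ne_zero.2 hre₁))) hn
  have hs₂ : (z - z₂) * (z - conj z₂) ∈ Complex.slitPlane := by
    refine Complex.mem_slitPlane_iff.2 (Or.inr ?_)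
    have : ((z - z₂) * (z - conj z₂)).im = 2 * z.im * (z.re - z₂.re) := by
      simp only [Complex.mul_im, Complex.sub_im, Complex.sub_re, Complex.conj_re, Complex.conj_im]
      ring
    rw [this]
    exact mul_ne_zero (by positivity) (sub_ne_zero.2 hre₂)
  have hQ₁ := ((hasDerivAt_id z).sub_const z₁).div ((hasDerivAt_id z).sub_const (conj z₁)) hb
  have hQ₂ := ((hasDerivAt_id z).sub_const z₂).mul ((hasDerivAt_id z).sub_const (conj z₂))
  have hf := fderiv_arg_comp hQ₁ hs₁ (1 / (2 * Real.pi))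
  have hg := fderiv_arg_comp hQ₂ hs₂ (1 / (2 * Real.pi))
  have hg' : (fun w => kontAngle w z₂) =
      fun w => (1 / (2 * Real.pi)) * Complex.arg ((w - z₂) * (w - conj z₂)) :=
    funext fun w => kontAngle_eq_arg_mul w z₂
  have hf' : (fun w => kontAngle z₁ w) =
      fun w => (1 / (2 * Real.pi)) * Complex.arg ((w - z₁) / (w - conj z₁)) := rfl
  simp only [Pi.div_apply, Pi.mul_apply, id] at hf hg
  rw [wedgeDensity, hf', hg', hf, hf, hg, hg]
  have e₁ : (1 * (z - conj z₁) - (z - z₁) * 1) / (z - conj z₁) ^ 2 / ((z - z₁) / (z - conj z₁))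
      = blaschkeLogDeriv z₁ z := by
    unfold blaschkeLogDeriv; field_simp
  have e₂ : (1 * (z - conj z₂) + (z - z₂) * 1) / ((z - z₂) * (z - conj z₂))
      = 1 / (z - z₂) + 1 / (z - conj z₂) := by
    field_simp
  rw [e₁, e₂]
  have e₃ : ∀ w : ℂ, blaschkeLogDeriv z₁ z / conj w = blaschkeLogDeriv z₁ z * conj (1 / w) := by
    intro w; simp [div_eq_mul_inv]
  rw [e₃, e₃]
  simp only [Complex.mul_im, Complex.add_re, Complex.add_im, Complex.conj_re, Complex.conj_im,
    Complex.I_re, Complex.I_im, Complex.one_re, Complex.one_im]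
  ring

theorem ae_wedgeDensity_eq {z₁ : ℂ} (h₁ : 0 < z₁.im) (z₂ : ℂ) :
    ∀ᵐ z : ℂ, 0 < z.im → wedgeDensity z₁ z₂ z = (1 / (2 * Real.pi)) ^ 2 *
      ((blaschkeLogDeriv z₁ z / conj (z - z₂)).im +
        (blaschkeLogDeriv z₁ z / conj (z - conj z₂)).im) := by
  filter_upwards [Complex.ae_re_ne z₁.re, Complex.ae_re_ne z₂.re] with z h h' hz
  exact wedgeDensity_eq h₁ hz h h'

theorem integrable_inv_norm_mul_one_add_norm_sq :
    Integrable fun z : ℂ => (‖z‖ * (1 + ‖z‖) ^ 2)⁻¹ := by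
  rw [integrable_fun_norm_addHaar (E := ℂ) volume (f := fun r : ℝ => (r * (1 + r) ^ 2)⁻¹)]
  have h := integrableOn_add_rpow_Ioi_of_lt (a := -2) (c := 0) (m := 1) (by norm_num) (by norm_num)
  refine h.congr_fun (fun r hr => ?_) measurableSet_Ioi
  have hr' : (0 : ℝ) < r := hr
  have : (r + 1) ^ (-2 : ℝ) = ((r + 1) ^ 2)⁻¹ := by
    rw [Real.rpow_neg (by positivity)]; norm_cast
  simp only [Complex.finrank_real_complex, smul_eq_mul, this]
  field_simp
  ring

theorem inv_mul_three_norm_le {a b c : ℂ} {δ : ℝ} (hδ : 0 < δ) (hab : δ ≤ ‖a - b‖)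
    (hac : δ ≤ ‖a - c‖) {z : ℂ} (hb : ‖z - a‖ ≤ ‖z - b‖) (hc : ‖z - a‖ ≤ ‖z - c‖) :
    (‖z - a‖ * ‖z - b‖ * ‖z - c‖)⁻¹
      ≤ (1 + 2 / δ) ^ 2 * (‖z - a‖ * (1 + ‖z - a‖) ^ 2)⁻¹ := by
  have key : ∀ w : ℂ, δ ≤ ‖a - w‖ → ‖z - a‖ ≤ ‖z - w‖ →
      1 + ‖z - a‖ ≤ (1 + 2 / δ) * ‖z - w‖ := by
    intro w hw hzw
    have htri : ‖a - w‖ ≤ ‖z - a‖ + ‖z - w‖ := by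
      rw [norm_sub_rev z a]; exact norm_sub_le_norm_sub_add_norm_sub a z w
    have : 1 ≤ 2 / δ * ‖z - w‖ := by
      rw [div_mul_eq_mul_div, le_div_iff₀ hδ]; linarith
    linarith
  rcases (norm_nonneg (z - a)).eq_or_lt with h0 | h0
  · simp [← h0]
  have hb0 := h0.trans_le hb
  have hc0 := h0.trans_le hc
  have hprod : (1 + ‖z - a‖) ^ 2 ≤ (1 + 2 / δ) ^ 2 * (‖z - b‖ * ‖z - c‖) := by
    calc (1 + ‖z - a‖) ^ 2 = (1 + ‖z - a‖) * (1 + ‖z - a‖) := by ring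
      _ ≤ ((1 + 2 / δ) * ‖z - b‖) * ((1 + 2 / δ) * ‖z - c‖) := by
        gcongr
        · exact key b hab hb
        · exact key c hac hc
      _ = _ := by ring
  rw [← div_eq_mul_inv, inv_eq_one_div, div_le_div_iff₀ (by positivity) (by positivity)]
  nlinarith [mul_le_mul_of_nonneg_left hprod h0.le]

theorem integrable_inv_mul_three_norm {a b c : ℂ} (hab : a ≠ b) (hac : a ≠ c) (hbc : b ≠ c) :
    Integrable fun z : ℂ => (‖z - a‖ * ‖z - b‖ * ‖z - c‖)⁻¹ := by
  obtain ⟨δ, hδ, h₁, h₂, h₃⟩ :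
      ∃ δ : ℝ, 0 < δ ∧ δ ≤ ‖a - b‖ ∧ δ ≤ ‖a - c‖ ∧ δ ≤ ‖b - c‖ := by
    refine ⟨min ‖a - b‖ (min ‖a - c‖ ‖b - c‖), ?_, by simp, by simp, by simp⟩
    simp [sub_ne_zero, hab, hac, hbc]
  have hI := integrable_inv_norm_mul_one_add_norm_sq
  have hsum := (((hI.comp_sub_right a).add (hI.comp_sub_right b)).add
    (hI.comp_sub_right c)).const_mul ((1 + 2 / δ) ^ 2)
  refine hsum.mono' (by fun_prop) (Filter.Eventually.of_forall fun z => ?_)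
  rw [Real.norm_of_nonneg (by positivity)]
  simp only [Pi.add_apply, mul_add]
  have pa : 0 ≤ (1 + 2 / δ) ^ 2 * (‖z - a‖ * (1 + ‖z - a‖) ^ 2)⁻¹ := by positivity
  have pb : 0 ≤ (1 + 2 / δ) ^ 2 * (‖z - b‖ * (1 + ‖z - b‖) ^ 2)⁻¹ := by positivity
  have pc : 0 ≤ (1 + 2 / δ) ^ 2 * (‖z - c‖ * (1 + ‖z - c‖) ^ 2)⁻¹ := by positivity
  have h₁' := norm_sub_rev a b ▸ h₁
  have h₂' := norm_sub_rev a c ▸ h₂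
  have h₃' := norm_sub_rev b c ▸ h₃
  have ha := inv_mul_three_norm_le (z := z) hδ h₁ h₂
  have hb := inv_mul_three_norm_le (z := z) hδ h₁' h₃
  have hc := inv_mul_three_norm_le (z := z) hδ h₂' h₃'
  rw [mul_comm ‖z - b‖ ‖z - a‖] at hb
  rw [mul_assoc, mul_comm ‖z - c‖] at hc
  rcases le_total ‖z - a‖ ‖z - b‖ with hab' | hab'
  · rcases le_total ‖z - a‖ ‖z - c‖ with hac' | hac'
    · linarith [ha hab' hac']
    · linarith [hc hac' (hac'.trans hab')]
  · rcases le_total ‖z - b‖ ‖z - c‖ with hbc' | hbc'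
    · linarith [hb hab' hbc']
    · linarith [hc (hbc'.trans hab') hbc']

/-- The Cauchy-type kernel attached to two points is odd under reflection in the line joining
them. -/
theorem setIntegral_ball_inv_mul_conj_inv (a c : ℂ) (R : ℝ) :
    ∫ z in Metric.ball c R, (1 / (z - a) / conj (z - c)).im = 0 := by
  rcases eq_or_ne a c with rfl | hac
  · have : ∀ z : ℂ, (1 / (z - a) / conj (z - a)).im = 0 := by
      intro z
      rw [div_div, Complex.mul_conj, ← Complex.ofReal_one, ← Complex.ofReal_div, Complex.ofReal_im]
    simp only [this, integral_zero]
  have hd : conj (a - c) ≠ 0 := (map_ne_zero _).2 (sub_ne_zero.2 hac)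
  obtain ⟨e, he, hed⟩ : ∃ e : ℂ, ‖e‖ = 1 ∧ e * conj (a - c) = a - c :=
    ⟨(a - c) / conj (a - c), by
      rw [norm_div, Complex.norm_conj, div_self (norm_ne_zero_iff.2 (sub_ne_zero.2 hac))],
      div_mul_cancel₀ _ hd⟩
  refine setIntegral_eq_zero_of_planeReflection_odd c he ?_ fun z => ?_
  · ext z
    simp only [Set.mem_preimage, mem_ball_iff_norm, planeReflection, add_sub_cancel_left, norm_mul,
      he, Complex.norm_conj, one_mul]
  · have hee : e * conj e = 1 := by
      rw [Complex.mul_conj, Complex.normSq_eq_norm_sq, he]; simp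
    have h : (planeReflection c e z - a) * conj (planeReflection c e z - c)
        = conj ((z - a) * conj (z - c)) := by
      simp only [planeReflection, add_sub_cancel_left, map_mul, Complex.conj_conj]
      have : c + e * conj (z - c) - a = e * conj (z - a) := by
        have h2 : conj (z - a) = conj (z - c) - conj (a - c) := by simp
        rw [h2]; linear_combination hed
      rw [this]
      linear_combination (conj (z - a) * (z - c)) * hee
    rw [div_div, div_div, h, ← map_one conj, ← map_div₀, Complex.conj_im, map_one]

theorem integrable_blaschkeLogDeriv_div {p c : ℂ} (hp : p ≠ conj p) (hpc : p ≠ c)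
    (hpc' : conj p ≠ c) :
    Integrable fun z : ℂ => (blaschkeLogDeriv p z / conj (z - c)).im := by
  refine ((integrable_inv_mul_three_norm hp hpc hpc').const_mul ‖p - conj p‖).mono'
    (Complex.measurable_im.comp (by unfold blaschkeLogDeriv; fun_prop)).aestronglyMeasurable ?_
  filter_upwards [Measure.ae_ne volume p, Measure.ae_ne volume (conj p)] with z ha hb
  have ha := sub_ne_zero.2 ha
  have hb := sub_ne_zero.2 hb
  have h : blaschkeLogDeriv p z = (p - conj p) / ((z - p) * (z - conj p)) := by
    unfold blaschkeLogDeriv; field_simp; ring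
  refine (Complex.abs_im_le_norm _).trans_eq ?_
  rw [h, norm_div, norm_div, norm_mul, Complex.norm_conj, div_div, div_eq_mul_inv]

theorem integrableOn_ball_inv_mul_conj_inv {a c : ℂ} (hac : a ≠ c) (R : ℝ) :
    IntegrableOn (fun z : ℂ => (1 / (z - a) / conj (z - c)).im) (Metric.ball c R) := by
  obtain ⟨b, hb⟩ : ∃ b, b ∉ ({a, c} : Set ℂ) := (Set.toFinite {a, c}).exists_notMem
  obtain ⟨hba, hbc⟩ : b ≠ a ∧ b ≠ c := by simpa using hb
  refine ((integrable_inv_mul_three_norm hba.symm hac hbc).const_mul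
    (R + ‖c - b‖)).integrableOn.mono'
      (Complex.measurable_im.comp (by fun_prop)).aestronglyMeasurable ?_
  filter_upwards [ae_restrict_mem Metric.isOpen_ball.measurableSet,
    ae_restrict_of_ae (Measure.ae_ne volume b)] with z hz hzb
  have hzb : 0 < ‖z - b‖ := norm_pos_iff.2 (sub_ne_zero.2 hzb)
  have hle : ‖z - b‖ ≤ R + ‖c - b‖ :=
    (norm_sub_le_norm_sub_add_norm_sub z c b).trans
      (add_le_add_left (mem_ball_iff_norm.1 hz).le _)
  calc ‖(1 / (z - a) / conj (z - c)).im‖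
      ≤ ‖1 / (z - a) / conj (z - c)‖ := Complex.abs_im_le_norm _
    _ = ‖z - b‖ * (‖z - a‖ * ‖z - b‖ * ‖z - c‖)⁻¹ := by
      rw [norm_div, norm_div, norm_one, Complex.norm_conj, div_div, one_div, mul_inv, mul_inv,
        mul_inv]
      field_simp
    _ ≤ (R + ‖c - b‖) * (‖z - a‖ * ‖z - b‖ * ‖z - c‖)⁻¹ := by gcongr

theorem integral_blaschkeLogDeriv_div {p c : ℂ} (hp : p ≠ conj p) (hpc : p ≠ c)
    (hpc' : conj p ≠ c) :
    ∫ z : ℂ, (blaschkeLogDeriv p z / conj (z - c)).im = 0 := by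
  have hlim := (aecover_ball (μ := volume) (x := c)
    Filter.tendsto_id).integral_tendsto_of_countably_generated
      (integrable_blaschkeLogDeriv_div hp hpc hpc')
  refine tendsto_nhds_unique hlim (tendsto_const_nhds.congr fun R => ?_)
  simp only [blaschkeLogDeriv, sub_div, Complex.sub_im]
  rw [integral_sub (integrableOn_ball_inv_mul_conj_inv hpc _)
    (integrableOn_ball_inv_mul_conj_inv hpc' _), setIntegral_ball_inv_mul_conj_inv,
    setIntegral_ball_inv_mul_conj_inv, sub_zero]

theorem setIntegral_blaschkeLogDeriv_div_conj (p c : ℂ) :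
    ∫ z in {z : ℂ | 0 < z.im}, (blaschkeLogDeriv p z / conj (z - conj c)).im =
      ∫ z in {z : ℂ | 0 < z.im}ᶜ, (blaschkeLogDeriv p z / conj (z - c)).im := by
  have h := setIntegral_planeReflection 0 norm_one
    (fun z => (blaschkeLogDeriv p z / conj (z - c)).im) {z : ℂ | z.im < 0}
  have hs : planeReflection 0 1 ⁻¹' {z : ℂ | z.im < 0} = {z : ℂ | 0 < z.im} := by
    ext z; simp [planeReflection]
  have hae : ({z : ℂ | 0 < z.im}ᶜ : Set ℂ) =ᵐ[volume] {z : ℂ | z.im < 0} := by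
    filter_upwards [Complex.ae_im_ne 0] with z hz
    exact propext ⟨fun h => lt_of_le_of_ne (not_lt.1 h) hz, fun h => not_lt.2 (le_of_lt h)⟩
  rw [setIntegral_congr_set hae, ← h, hs]
  congr 1
  funext z
  have h1 : blaschkeLogDeriv p (planeReflection 0 1 z) = -conj (blaschkeLogDeriv p z) := by
    simp [blaschkeLogDeriv, planeReflection]
  have h2 : planeReflection 0 1 z - c = conj (z - conj c) := by simp [planeReflection]
  rw [h1, h2, neg_div, Complex.neg_im, ← map_div₀, Complex.conj_im, neg_neg]

theorem setIntegral_wedgeDensity {z₁ : ℂ} (h₁ : 0 < z₁.im) (z₂ : ℂ) {s : Set ℂ}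
    (hs : s =ᵐ[volume] {z : ℂ | 0 < z.im}) :
    ∫ z in s, wedgeDensity z₁ z₂ z = (1 / (2 * Real.pi)) ^ 2 *
      ∫ z in {z : ℂ | 0 < z.im}, ((blaschkeLogDeriv z₁ z / conj (z - z₂)).im +
        (blaschkeLogDeriv z₁ z / conj (z - conj z₂)).im) := by
  rw [setIntegral_congr_set hs, ← integral_const_mul]
  exact setIntegral_congr_ae (measurableSet_lt measurable_const Complex.measurable_im)
    (ae_wedgeDensity_eq h₁ z₂)

theorem setIntegral_blaschkeLogDeriv_self (p : ℂ) :
    ∫ z in {z : ℂ | 0 < z.im}, ((blaschkeLogDeriv p z / conj (z - p)).im +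
      (blaschkeLogDeriv p z / conj (z - conj p)).im) = 0 := by
  have he : ‖(-1 : ℂ)‖ = 1 := by simp
  refine setIntegral_eq_zero_of_planeReflection_odd (p.re : ℂ) he ?_ fun z => ?_
  · ext z; simp [planeReflection]
  · have ha : planeReflection p.re (-1) z - p = -conj (z - p) := by
      apply Complex.ext <;> simp [planeReflection, sub_eq_add_neg, add_comm]
    have hb : planeReflection p.re (-1) z - conj p = -conj (z - conj p) := by
      apply Complex.ext <;> simp [planeReflection, sub_eq_add_neg, add_comm]
    have hB : blaschkeLogDeriv p (planeReflection p.re (-1) z) = -conj (blaschkeLogDeriv p z) := by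
      simp only [blaschkeLogDeriv, ha, hb, div_neg, map_sub, map_div₀, map_one]
      ring
    have hn : ∀ u v : ℂ, (-conj u / conj (-conj v)).im = -(u / conj v).im := by
      intro u v
      rw [map_neg, neg_div_neg_eq, ← map_div₀, Complex.conj_im]
    rw [hB, ha, hb, hn, hn]
    ring

/-- Kontsevich's vanishing lemmas for two-point angle integrals over the upper half-plane. -/
theorem kontsevich_two_point_vanishing :
    (∀ z₀ : ℂ, 0 < z₀.im →
      ∫ z in {z : ℂ | 0 < z.im ∧ z ≠ z₀}, wedgeDensity z₀ z₀ z = 0) ∧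
    (∀ z₁ z₂ : ℂ, 0 < z₁.im → 0 ≤ z₂.im → z₁ ≠ z₂ →
      ∫ z in {z : ℂ | 0 < z.im ∧ z ≠ z₁ ∧ z ≠ z₂}, wedgeDensity z₁ z₂ z = 0) := by
  refine ⟨fun z₀ h₀ => ?_, fun z₁ z₂ h₁ h₂ hne => ?_⟩
  · have hs : {z : ℂ | 0 < z.im ∧ z ≠ z₀} =ᵐ[volume] {z : ℂ | 0 < z.im} := by
      filter_upwards [Measure.ae_ne volume z₀] with z hz
      exact propext ⟨fun h => h.1, fun h => ⟨h, hz⟩⟩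
    rw [setIntegral_wedgeDensity h₀ z₀ hs, setIntegral_blaschkeLogDeriv_self, mul_zero]
  · have hs : {z : ℂ | 0 < z.im ∧ z ≠ z₁ ∧ z ≠ z₂} =ᵐ[volume] {z : ℂ | 0 < z.im} := by
      filter_upwards [Measure.ae_ne volume z₁, Measure.ae_ne volume z₂] with z hz hz'
      exact propext ⟨fun h => h.1, fun h => ⟨h, hz, hz'⟩⟩
    have him : ∀ w : ℂ, 0 ≤ w.im → conj z₁ ≠ w := fun w hw h => by
      have := congrArg Complex.im h
      rw [Complex.conj_im] at this
      linarith
    have hp : z₁ ≠ conj z₁ := (him z₁ h₁.le).symm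
    have hne' : conj z₁ ≠ conj z₂ := fun h => hne (star_injective h)
    have hp' : z₁ ≠ conj z₂ := fun h => him z₂ h₂ (by rw [h, Complex.conj_conj])
    have hI := integrable_blaschkeLogDeriv_div hp hne (him z₂ h₂)
    have hI' := integrable_blaschkeLogDeriv_div hp hp' hne'
    have hm : MeasurableSet {z : ℂ | 0 < z.im} :=
      measurableSet_lt measurable_const Complex.measurable_im
    rw [setIntegral_wedgeDensity h₁ z₂ hs, integral_add hI.integrableOn hI'.integrableOn,
      setIntegral_blaschkeLogDeriv_div_conj, integral_add_compl hm hI,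
      integral_blaschkeLogDeriv_div hp hne (him z₂ h₂), mul_zero]
end
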